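/- arXiv:1808.10706 — 2 statements merged into one kernel-verified Lean document; each statement's English description precedes it below -/
import Mathlib

section
/- Under hypotheses (H1)–(H3), the resolvent conserves mass: for every λ > 0 and f ∈ L¹(ℝ^d), every distributional solution u ∈ L¹(ℝ^d) of the resolvent equation u − λ Σ_{i,j=1}^d ∂_i∂_j(a_ij(x,u)u) + λ div(b(x,u)u) = f satisfies ∫_{ℝ^d} u(x) dx = ∫_{ℝ^d} f(x) dx. -/
open MeasureTheory Filter

/-- The `i`-th partial derivative of `φ : ℝ^d → ℝ`. -/
noncomputable def pd {d : ℕ} (i : Fin d) (φ : (Fin d → ℝ) → ℝ) (x : Fin d → ℝ) : ℝ :=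
  fderiv ℝ φ x (Pi.single i 1)

/-- The second partial derivative `∂_i ∂_j φ`. -/
noncomputable def pd2 {d : ℕ} (i j : Fin d) (φ : (Fin d → ℝ) → ℝ) (x : Fin d → ℝ) : ℝ :=
  pd i (pd j φ) x

/-- `u ∈ L¹(ℝ^d)` is a distributional solution of the resolvent equation
`u - λ Σ_{i,j} ∂_i∂_j(a_ij(x,u)u) + λ div(b(x,u)u) = f`. -/
def IsWeakResolventSol {d : ℕ} (a : Fin d → Fin d → (Fin d → ℝ) → ℝ → ℝ)
    (b : Fin d → (Fin d → ℝ) → ℝ → ℝ) (lam : ℝ) (f u : (Fin d → ℝ) → ℝ) : Prop :=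
  Integrable u ∧
  ∀ φ : (Fin d → ℝ) → ℝ, ContDiff ℝ (⊤ : ℕ∞) φ → HasCompactSupport φ →
    (∫ x, u x * φ x) - lam * ∑ i, ∑ j, (∫ x, a i j x (u x) * u x * pd2 i j φ x)
      - lam * (∫ x, u x * ∑ i, b i x (u x) * pd i φ x) = ∫ x, f x * φ x

open Topology

lemma pd_scale {d : ℕ} (i : Fin d) (φ : (Fin d → ℝ) → ℝ) (c : ℝ) (x : Fin d → ℝ) :
    pd i (fun y => φ (c • y)) x = c * pd i φ (c • x) := by
  unfold pd
  rw [fderiv_comp_smul]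
  simp

lemma pd_const_mul {d : ℕ} (i : Fin d) (φ : (Fin d → ℝ) → ℝ) (c : ℝ) (x : Fin d → ℝ) :
    pd i (fun y => c * φ y) x = c * pd i φ x := by
  unfold pd
  have : (fun y => c * φ y) = c • φ := by ext y; simp
  rw [this, fderiv_const_smul_field]
  simp

lemma pd2_scale {d : ℕ} (i j : Fin d) (φ : (Fin d → ℝ) → ℝ) (c : ℝ) (x : Fin d → ℝ) :
    pd2 i j (fun y => φ (c • y)) x = c * (c * pd2 i j φ (c • x)) := by
  unfold pd2
  have : pd j (fun y => φ (c • y)) = fun y => c * pd j φ (c • y) := by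
    ext y; exact pd_scale j φ c y
  rw [this, pd_const_mul, pd_scale]

lemma pd_smooth {d : ℕ} (i : Fin d) (φ : (Fin d → ℝ) → ℝ) (h : ContDiff ℝ (⊤ : ℕ∞) φ) :
    ContDiff ℝ (⊤ : ℕ∞) (pd i φ) := by
  have h1 : ContDiff ℝ (⊤ : ℕ∞) (fderiv ℝ φ) := h.fderiv_right (by simp)
  exact h1.clm_apply contDiff_const

lemma pd_cpt {d : ℕ} (i : Fin d) (φ : (Fin d → ℝ) → ℝ) (h : HasCompactSupport φ) :
    HasCompactSupport (pd i φ) :=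
  h.fderiv_apply ℝ (Pi.single i 1)

lemma bdd_of_cpt {d : ℕ} (φ : (Fin d → ℝ) → ℝ) (h : ContDiff ℝ (⊤ : ℕ∞) φ)
    (hc : HasCompactSupport φ) : ∃ C : ℝ, ∀ x, |φ x| ≤ C := by
  obtain ⟨C, hC⟩ := hc.exists_bound_of_continuous h.continuous
  exact ⟨C, fun x => by simpa using hC x⟩

lemma tendsto_cut {d : ℕ} (φ : (Fin d → ℝ) → ℝ) (h : ContDiff ℝ (⊤ : ℕ∞) φ)
    (hc : HasCompactSupport φ) (h0 : φ 0 = 1) (g : (Fin d → ℝ) → ℝ) (hg : Integrable g)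
    (e : ℕ → ℝ) (he : Tendsto e atTop (𝓝 0)) :
    Tendsto (fun n => ∫ x, g x * φ (e n • x)) atTop (𝓝 (∫ x, g x)) := by
  obtain ⟨C, hC⟩ := bdd_of_cpt φ h hc
  have hcont := h.continuous
  refine tendsto_integral_of_dominated_convergence (fun x => |g x| * C) ?_ ?_ ?_ ?_
  · intro n
    exact hg.aestronglyMeasurable.mul (by fun_prop : Continuous fun x => φ (e n • x)).aestronglyMeasurable
  · exact hg.abs.mul_const C
  · intro n
    refine Eventually.of_forall fun x => ?_
    rw [Real.norm_eq_abs, abs_mul]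
    exact mul_le_mul_of_nonneg_left (hC _) (abs_nonneg _)
  · refine Eventually.of_forall fun x => ?_
    have h1 : Tendsto (fun n => e n • x) atTop (𝓝 ((0 : ℝ) • x)) := he.smul_const x
    rw [zero_smul] at h1
    have h2 := ((hcont.tendsto 0).comp h1).const_mul (g x)
    rw [h0, mul_one] at h2
    exact h2

lemma tendsto_err {d : ℕ} (u : (Fin d → ℝ) → ℝ) (hu : Integrable u) (e : ℕ → ℝ)
    (he : Tendsto e atTop (𝓝 0)) (F : ℕ → (Fin d → ℝ) → ℝ) (K : ℝ)
    (hF : ∀ n x, |F n x| ≤ |u x| * (K * |e n|)) :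
    Tendsto (fun n => ∫ x, F n x) atTop (𝓝 0) := by
  have hb : ∀ n, ‖∫ x, F n x‖ ≤ (∫ x, |u x|) * (K * |e n|) := by
    intro n
    rw [← integral_mul_const]
    exact norm_integral_le_of_norm_le (hu.abs.mul_const _) (Eventually.of_forall fun x => hF n x)
  refine squeeze_zero_norm hb ?_
  have := ((he.abs.const_mul K).const_mul (∫ x, |u x|))
  simpa using this

/-- under (H1)–(H3), the resolvent conserves mass. -/
theorem statement3 (d : ℕ) (a : Fin d → Fin d → (Fin d → ℝ) → ℝ → ℝ)
    (b : Fin d → (Fin d → ℝ) → ℝ → ℝ) (γ : ℝ)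
    (hd : 1 ≤ d)
    (ha_smooth : ∀ i j, ContDiff ℝ 2 (fun p : (Fin d → ℝ) × ℝ => a i j p.1 p.2))
    (ha_bdd : ∀ i j, ∃ M : ℝ, ∀ (x : Fin d → ℝ) (r : ℝ), |a i j x r| ≤ M)
    (hax_cont : ∀ i j,
      Continuous (fun p : (Fin d → ℝ) × ℝ => fderiv ℝ (fun y => a i j y p.2) p.1))
    (hax_bdd : ∀ i j, ∃ M : ℝ, ∀ (x : Fin d → ℝ) (r : ℝ),
      ‖fderiv ℝ (fun y => a i j y r) x‖ ≤ M)
    (ha_symm : ∀ i j x r, a i j x r = a j i x r)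
    (hγ : 0 < γ)
    (hH2 : ∀ (x ξ : Fin d → ℝ) (r : ℝ),
      γ * ∑ i, ξ i ^ 2 ≤ ∑ i, ∑ j, (a i j x r + r * deriv (fun s => a i j x s) r) * ξ i * ξ j)
    (hb_smooth : ∀ i, ContDiff ℝ 1 (fun p : (Fin d → ℝ) × ℝ => b i p.1 p.2))
    (hb_bdd : ∀ i, ∃ M : ℝ, ∀ (x : Fin d → ℝ) (r : ℝ), |b i x r| ≤ M)
    (hb_zero : ∀ i x, b i x 0 = 0)
    (lam : ℝ) (hlam : 0 < lam)
    (f : (Fin d → ℝ) → ℝ) (hf : Integrable f)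
    (u : (Fin d → ℝ) → ℝ) (hu : IsWeakResolventSol a b lam f u) :
    (∫ x, u x) = ∫ x, f x := by
  obtain ⟨hu1, hu2⟩ := hu
  obtain ⟨φ, hφ, hφc, hφ0⟩ : ∃ φ : (Fin d → ℝ) → ℝ, ContDiff ℝ (⊤ : ℕ∞) φ ∧
      HasCompactSupport φ ∧ φ 0 = 1 := by
    let B : ContDiffBump (0 : Fin d → ℝ) := default
    exact ⟨B, B.contDiff, B.hasCompactSupport,
      B.one_of_mem_closedBall (Metric.mem_closedBall_self B.rIn_pos.le)⟩
  let e : ℕ → ℝ := fun n => 1 / ((n : ℝ) + 1)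
  have he : Tendsto e atTop (𝓝 0) := tendsto_one_div_add_atTop_nhds_zero_nat
  have hepos : ∀ n, 0 < e n := fun n => by positivity
  have hele : ∀ n, |e n| ≤ 1 := fun n => by
    rw [abs_of_pos (hepos n)]
    exact (div_le_one (by positivity)).2 (by linarith [(Nat.cast_nonneg n : (0 : ℝ) ≤ n)])
  have h1 := tendsto_cut φ hφ hφc hφ0 u hu1 e he
  have h2 := tendsto_cut φ hφ hφc hφ0 f hf e he
  have h3 : ∀ i j, Tendsto (fun n => ∫ x, a i j x (u x) * u x * pd2 i j (fun y => φ (e n • y)) x)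
      atTop (𝓝 0) := by
    intro i j
    obtain ⟨M, hM⟩ := ha_bdd i j
    obtain ⟨C, hC⟩ := bdd_of_cpt (pd2 i j φ) (pd_smooth i _ (pd_smooth j φ hφ))
      (pd_cpt i _ (pd_cpt j φ hφc))
    have hM0 : 0 ≤ M := (abs_nonneg _).trans (hM 0 0)
    have hC0 : 0 ≤ C := (abs_nonneg _).trans (hC 0)
    refine tendsto_err u hu1 e he _ (M * C) fun n x => ?_
    rw [pd2_scale]
    simp only [abs_mul]
    calc |a i j x (u x)| * |u x| * (|e n| * (|e n| * |pd2 i j φ (e n • x)|))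
        ≤ M * |u x| * (|e n| * (1 * C)) := by
          gcongr
          · exact hM _ _
          · exact hele n
          · exact hC _
      _ = |u x| * (M * C * |e n|) := by ring
  have h4 : Tendsto (fun n => ∫ x, u x * ∑ i, b i x (u x) * pd i (fun y => φ (e n • y)) x)
      atTop (𝓝 0) := by
    choose M hM using hb_bdd
    have hC' : ∀ i, ∃ C : ℝ, ∀ x, |pd i φ x| ≤ C := fun i =>
      bdd_of_cpt (pd i φ) (pd_smooth i φ hφ) (pd_cpt i φ hφc)
    choose C hC using hC'
    refine tendsto_err u hu1 e he _ (∑ i, M i * C i) fun n x => ?_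
    rw [abs_mul, Finset.sum_mul]
    refine mul_le_mul_of_nonneg_left ?_ (abs_nonneg _)
    refine (Finset.abs_sum_le_sum_abs _ _).trans (Finset.sum_le_sum fun i _ => ?_)
    have hM0 : 0 ≤ M i := (abs_nonneg _).trans (hM i 0 0)
    rw [pd_scale, abs_mul, abs_mul]
    calc |b i x (u x)| * (|e n| * |pd i φ (e n • x)|) ≤ M i * (|e n| * C i) := by
          gcongr
          · exact hM i _ _
          · exact hC i _
      _ = M i * C i * |e n| := by ring
  have h5 : Tendsto (fun n => ∑ i, ∑ j,
      ∫ x, a i j x (u x) * u x * pd2 i j (fun y => φ (e n • y)) x) atTop (𝓝 0) := by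
    have := tendsto_finsetSum (Finset.univ : Finset (Fin d)) fun i _ =>
      tendsto_finsetSum (Finset.univ : Finset (Fin d)) fun j _ => h3 i j
    simpa using this
  have h6 := (h1.sub (h5.const_mul lam)).sub (h4.const_mul lam)
  simp only [mul_zero, sub_zero] at h6
  refine tendsto_nhds_unique h6 (h2.congr fun n => ?_)
  refine (hu2 (fun y => φ (e n • y)) ?_ ?_).symm
  · exact hφ.comp (contDiff_const_smul (e n))
  · exact hφc.comp_smul (hepos n).ne'
end

section
/- Under hypotheses (H1)′–(H3)′, the degenerate nonlinear Fokker–Planck equation generates a continuous contraction semigroup on L¹(ℝ^d): there exists a family of maps S_t : L¹(ℝ^d) → L¹(ℝ^d), t ≥ 0, such that S_0 is the identity, S_{t+s} = S_t ∘ S_s for all t, s ≥ 0, ‖S_t v − S_t w‖_{L¹} ≤ ‖v − w‖_{L¹} for all v, w ∈ L¹(ℝ^d) and t ≥ 0, for each u₀ ∈ L¹(ℝ^d) the map t ↦ S_t u₀ is continuous from [0,∞) to L¹(ℝ^d), and u(t,x) := (S_t u₀)(x) is a distributional solution of ∂_t u = Σ_{i,j=1}^d ∂_i∂_j(a_ij(u)u)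 − div(b(u)u), i.e., for every φ ∈ C_c^∞((0,∞) × ℝ^d): ∫₀^∞ ∫_{ℝ^d} ( u(t,x) ∂_tφ(t,x) + Σ_{i,j=1}^d a_ij(u(t,x)) u(t,x) ∂_{x_i}∂_{x_j}φ(t,x) + u(t,x) b(u(t,x))·∇_xφ(t,x) ) dx dt = 0. -/
open MeasureTheory Filter

/-- Time derivative `∂_t φ` for `φ : ℝ × ℝ^d → ℝ`. -/
noncomputable def pdt {d : ℕ} (φ : ℝ × (Fin d → ℝ) → ℝ) (p : ℝ × (Fin d → ℝ)) : ℝ :=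
  fderiv ℝ φ p ((1 : ℝ), (0 : Fin d → ℝ))

/-- Spatial partial derivative `∂_{x_i} φ` for `φ : ℝ × ℝ^d → ℝ`. -/
noncomputable def pdx {d : ℕ} (i : Fin d) (φ : ℝ × (Fin d → ℝ) → ℝ) (p : ℝ × (Fin d → ℝ)) : ℝ :=
  fderiv ℝ φ p ((0 : ℝ), (Pi.single i 1 : Fin d → ℝ))

/-- Second spatial partial derivative `∂_{x_i}∂_{x_j} φ`. -/
noncomputable def pdxx {d : ℕ} (i j : Fin d) (φ : ℝ × (Fin d → ℝ) → ℝ)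
    (p : ℝ × (Fin d → ℝ)) : ℝ :=
  pdx i (pdx j φ) p

/-- Distributional solution of the degenerate nonlinear Fokker–Planck equation
`∂_t u = Σ_{i,j} ∂_i∂_j(a_ij(u)u) - div(b(u)u)` on `(0,∞) × ℝ^d`. -/
def IsFPESol' {d : ℕ} (a : Fin d → Fin d → ℝ → ℝ)
    (b : Fin d → ℝ → ℝ) (u : ℝ → (Fin d → ℝ) → ℝ) : Prop :=
  ∀ φ : ℝ × (Fin d → ℝ) → ℝ, ContDiff ℝ (⊤ : ℕ∞) φ → HasCompactSupport φ →
    tsupport φ ⊆ {p : ℝ × (Fin d → ℝ) | 0 < p.1} →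
    (∫ t in Set.Ioi (0 : ℝ), ∫ x, (u t x * pdt φ (t, x)
      + ∑ i, ∑ j, a i j (u t x) * u t x * pdxx i j φ (t, x)
      + u t x * ∑ i, b i (u t x) * pdx i φ (t, x))) = 0

section Taylor
variable {V F : Type*} [NormedAddCommGroup V] [NormedSpace ℝ V] [NormedAddCommGroup F]
  [NormedSpace ℝ F]

lemma taylor_one (f : V → F) (hf : ContDiff ℝ 2 f) (hc : HasCompactSupport f) :
    ∃ C : ℝ, 0 ≤ C ∧ ∀ x w, ‖f (x + w) - f x - fderiv ℝ f x w‖ ≤ C * ‖w‖ ^ 2 := by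
  have h1 : ContDiff ℝ 1 (fderiv ℝ f) := hf.fderiv_right (by norm_num)
  obtain ⟨C, hC⟩ := h1.lipschitzWith_of_hasCompactSupport (hc.fderiv ℝ) (by norm_num)
  refine ⟨C, C.2, fun x w => ?_⟩
  have := (convex_segment x (x + w)).norm_image_sub_le_of_norm_hasFDerivWithin_le'
    (f := f) (f' := fderiv ℝ f) (φ := fderiv ℝ f x) (C := C * ‖w‖) (x := x) (y := x + w)
    (fun y _ => ((hf.differentiable (by norm_num)) y).hasFDerivAt.hasFDerivWithinAt)
    (fun y hy => by
      have h2 := hC.dist_le_mul y x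
      rw [dist_eq_norm, dist_eq_norm] at h2
      refine h2.trans ?_
      gcongr
      rw [segment_eq_image'] at hy
      obtain ⟨θ, hθ, rfl⟩ := hy
      simp only [add_sub_cancel_left, norm_smul, Real.norm_eq_abs, abs_of_nonneg hθ.1]
      exact mul_le_of_le_one_left (norm_nonneg _) hθ.2)
    (left_mem_segment _ _ _) (right_mem_segment _ _ _)
  simp only [add_sub_cancel_left] at this
  nlinarith [this]

lemma taylor_two (f : V → F) (hf : ContDiff ℝ 3 f) (hc : HasCompactSupport f) :
    ∃ C : ℝ, 0 ≤ C ∧ ∀ x w, ‖f (x + w) - f x - fderiv ℝ f x w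
      - (1 / 2 : ℝ) • fderiv ℝ (fderiv ℝ f) x w w‖ ≤ C * ‖w‖ ^ 3 := by
  have h1 : ContDiff ℝ 2 (fderiv ℝ f) := hf.fderiv_right (by norm_num)
  obtain ⟨C, hC0, hC⟩ := taylor_one _ h1 (hc.fderiv ℝ)
  refine ⟨C, hC0, fun x w => ?_⟩
  have hd : Differentiable ℝ f := hf.differentiable (by norm_num)
  have key := norm_image_sub_le_of_norm_deriv_le_segment_01'
    (f := fun s : ℝ => f (x + s • w) - s • fderiv ℝ f x w
      - (s ^ 2 / 2) • fderiv ℝ (fderiv ℝ f) x w w)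
    (f' := fun s : ℝ => fderiv ℝ f (x + s • w) w - fderiv ℝ f x w
      - s • fderiv ℝ (fderiv ℝ f) x w w) (C := C * ‖w‖ ^ 3)
    (fun s _ => by
      have e1 : HasDerivAt (fun s : ℝ => x + s • w) w s := by
        simpa using ((hasDerivAt_id s).smul_const w).const_add x
      have e2 := (hd (x + s • w)).hasFDerivAt.comp_hasDerivAt s e1
      have e3 := (hasDerivAt_id s).smul_const (fderiv ℝ f x w)
      have e4 := (((hasDerivAt_id s).pow 2).div_const 2).smul_const
        (fderiv ℝ (fderiv ℝ f) x w w)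
      have := (e2.sub e3).sub e4
      refine HasDerivAt.hasDerivWithinAt ?_
      convert! this using 1
      simp)
    (fun s hs => by
      have h2 := hC x (s • w)
      have e : fderiv ℝ f (x + s • w) w - fderiv ℝ f x w - s • fderiv ℝ (fderiv ℝ f) x w w
        = (fderiv ℝ f (x + s • w) - fderiv ℝ f x - fderiv ℝ (fderiv ℝ f) x (s • w)) w := by
        simp
      rw [e]
      refine (ContinuousLinearMap.le_opNorm _ _).trans ?_
      have h3 : ‖s • w‖ ≤ ‖w‖ := by
        rw [norm_smul, Real.norm_eq_abs, abs_of_nonneg hs.1]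
        exact mul_le_of_le_one_left (norm_nonneg _) hs.2.le
      have h4 : C * ‖s • w‖ ^ 2 ≤ C * ‖w‖ ^ 2 := by gcongr
      have := mul_le_mul_of_nonneg_right (h2.trans h4) (norm_nonneg w)
      calc _ ≤ _ := this
        _ = _ := by ring)
  refine le_trans (le_of_eq ?_) key
  congr 1
  simp
  abel
end Taylor

lemma fderiv_eq_sum_pd {d : ℕ} (ψ : (Fin d → ℝ) → ℝ) (x w : Fin d → ℝ) :
    fderiv ℝ ψ x w = ∑ i, w i * pd i ψ x := by
  conv_lhs => rw [pi_eq_sum_univ' w]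
  simp only [map_sum, map_smul, smul_eq_mul, pd]

lemma pd2_eq {d : ℕ} (ψ : (Fin d → ℝ) → ℝ) (hψ : ContDiff ℝ 2 ψ) (i j : Fin d)
    (x : Fin d → ℝ) :
    pd2 i j ψ x = fderiv ℝ (fderiv ℝ ψ) x (Pi.single i 1) (Pi.single j 1) := by
  unfold pd2 pd
  have h1 : ContDiff ℝ 1 (fderiv ℝ ψ) := hψ.fderiv_right (by norm_num)
  have := ((h1.differentiable (by norm_num)) x).hasFDerivAt.clm_apply
    (hasFDerivAt_const (Pi.single j (1:ℝ) : Fin d → ℝ) x)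
  rw [this.fderiv]
  simp

lemma fderiv2_eq_sum_pd2 {d : ℕ} (ψ : (Fin d → ℝ) → ℝ) (hψ : ContDiff ℝ 2 ψ)
    (x w : Fin d → ℝ) :
    fderiv ℝ (fderiv ℝ ψ) x w w = ∑ i, ∑ j, w i * w j * pd2 i j ψ x := by
  conv_lhs => rw [pi_eq_sum_univ' w]
  simp only [map_sum, map_smul, smul_eq_mul, pd2_eq ψ hψ, _root_.sum_apply,
    _root_.smul_apply]
  rw [Finset.sum_comm]
  refine Finset.sum_congr rfl fun i _ => ?_
  rw [Finset.mul_sum]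
  refine Finset.sum_congr rfl fun j _ => ?_
  ring

/-- Step of the Cholesky decomposition. -/
noncomputable def cholV {d : ℕ} (k : Fin d) (A : Fin d → Fin d → ℝ) (i : Fin d) : ℝ :=
  A i k / Real.sqrt (A k k)

noncomputable def cholA {d : ℕ} (k : Fin d) (A : Fin d → Fin d → ℝ) (i j : Fin d) : ℝ :=
  A i j - cholV k A i * cholV k A j

def IsPSD {d : ℕ} (A : Fin d → Fin d → ℝ) : Prop :=
  (∀ i j, A i j = A j i) ∧ ∀ ξ : Fin d → ℝ, 0 ≤ ∑ i, ∑ j, A i j * ξ i * ξ j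

lemma psd_quad {d : ℕ} {A : Fin d → Fin d → ℝ} (h : IsPSD A) (k : Fin d) (s : ℝ)
    (ξ : Fin d → ℝ) :
    0 ≤ (∑ i, ∑ j, A i j * ξ i * ξ j) + 2 * s * (∑ i, A i k * ξ i) + s ^ 2 * A k k := by
  have := h.2 (fun i => ξ i + s * (if i = k then 1 else 0))
  refine this.trans (le_of_eq ?_)
  have e : ∀ i j, A i j * (ξ i + s * (if i = k then 1 else 0)) *
      (ξ j + s * (if j = k then 1 else 0)) =
      A i j * ξ i * ξ j + (if j = k then s * (A i j * ξ i) else 0)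
       + (if i = k then s * (A i j * ξ j) else 0)
       + (if i = k then (if j = k then s ^ 2 * A i j else 0) else 0) := by
    intro i j
    split_ifs <;> ring
  simp only [e, Finset.sum_add_distrib, Finset.sum_ite_eq', Finset.mem_univ, if_true]
  have e2 : ∑ x, ∑ x_1, (if x = k then s * (A x x_1 * ξ x_1) else 0) =
      ∑ x, s * (A x k * ξ x) := by
    rw [Finset.sum_comm]
    simp only [Finset.sum_ite_eq', Finset.mem_univ, if_true]
    exact Finset.sum_congr rfl fun i _ => by rw [h.1 k i]
  have e3 : ∑ x, ∑ x_1, (if x = k then (if x_1 = k then s ^ 2 * A x x_1 else 0) else 0) =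
      s ^ 2 * A k k := by
    rw [Finset.sum_comm]
    simp [Finset.sum_ite_eq']
  rw [e2, e3, ← Finset.mul_sum]
  ring

lemma psd_diag {d : ℕ} {A : Fin d → Fin d → ℝ} (h : IsPSD A) (k : Fin d) : 0 ≤ A k k := by
  have := psd_quad h k 1 0
  simpa using this

lemma psd_row_zero {d : ℕ} {A : Fin d → Fin d → ℝ} (h : IsPSD A) (k : Fin d)
    (hk : A k k = 0) (i : Fin d) : A i k = 0 := by
  by_contra hne
  have h1 := psd_quad h k (-(A i i + 1) / (2 * A i k)) (Pi.single i 1)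
  have e1 : ∑ i', A i' k * (Pi.single i 1 : Fin d → ℝ) i' = A i k := by
    simp [Pi.single_apply]
  have e2 : ∑ a, ∑ b, A a b * (Pi.single i 1 : Fin d → ℝ) a * (Pi.single i 1 : Fin d → ℝ) b
      = A i i := by
    simp [Pi.single_apply]
  rw [e1, e2, hk] at h1
  have : 2 * (-(A i i + 1) / (2 * A i k)) * A i k = -(A i i + 1) := by
    field_simp
  rw [this] at h1
  linarith

lemma cholA_psd {d : ℕ} {A : Fin d → Fin d → ℝ} (h : IsPSD A) (k : Fin d) :
    IsPSD (cholA k A) := by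
  refine ⟨fun i j => by unfold cholA; rw [h.1 i j]; ring, fun ξ => ?_⟩
  have e : ∑ i, ∑ j, cholA k A i j * ξ i * ξ j =
      (∑ i, ∑ j, A i j * ξ i * ξ j) - (∑ i, cholV k A i * ξ i) ^ 2 := by
    rw [sq, Finset.sum_mul_sum, ← Finset.sum_sub_distrib]
    refine Finset.sum_congr rfl fun i _ => ?_
    rw [← Finset.sum_sub_distrib]
    refine Finset.sum_congr rfl fun j _ => ?_
    unfold cholA; ring
  rw [e]
  have e2 : ∑ i, cholV k A i * ξ i = (∑ i, A i k * ξ i) / Real.sqrt (A k k) := by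
    rw [Finset.sum_div]
    refine Finset.sum_congr rfl fun i _ => ?_
    unfold cholV; ring
  rw [e2, div_pow, Real.sq_sqrt (psd_diag h k)]
  rcases (psd_diag h k).eq_or_lt with h0 | h0
  · rw [← h0]; simpa using h.2 ξ
  · have := psd_quad h k (-(∑ i, A i k * ξ i) / A k k) ξ
    refine this.trans (le_of_eq ?_)
    field_simp
    ring

lemma cholA_row {d : ℕ} {A : Fin d → Fin d → ℝ} (h : IsPSD A) (k : Fin d) (i : Fin d) :
    cholA k A i k = 0 := by
  unfold cholA cholV
  rcases (psd_diag h k).eq_or_lt with h0 | h0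
  · rw [← h0, psd_row_zero h k h0.symm i]; simp
  · have h1 : Real.sqrt (A k k) ≠ 0 := (Real.sqrt_pos.2 h0).ne'
    have h2 : Real.sqrt (A k k) * Real.sqrt (A k k) = A k k := Real.mul_self_sqrt h0.le
    rw [div_mul_div_comm, h2]
    field_simp
    ring

lemma cholA_row_keep {d : ℕ} {A : Fin d → Fin d → ℝ} (h : IsPSD A) (k l : Fin d)
    (hl : ∀ i, A i l = 0) (i : Fin d) : cholA k A i l = 0 := by
  unfold cholA cholV
  rw [hl i, h.1 l k, hl k]; simp

/-- Iterated Cholesky remainder. -/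
noncomputable def cholR {d : ℕ} (A : Fin d → Fin d → ℝ) : ℕ → Fin d → Fin d → ℝ
  | 0 => A
  | n + 1 => if hn : n < d then cholA ⟨n, hn⟩ (cholR A n) else cholR A n

noncomputable def cholS {d : ℕ} (A : Fin d → Fin d → ℝ) (k : Fin d) : Fin d → ℝ :=
  cholV k (cholR A k)

lemma cholR_psd {d : ℕ} {A : Fin d → Fin d → ℝ} (h : IsPSD A) (n : ℕ) : IsPSD (cholR A n) := by
  induction n with
  | zero => exact h
  | succ n ih =>
    rw [cholR]; split_ifs
    · exact cholA_psd ih _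
    · exact ih

lemma cholR_zero {d : ℕ} {A : Fin d → Fin d → ℝ} (h : IsPSD A) (n : ℕ) (l : Fin d)
    (hl : (l : ℕ) < n) (i : Fin d) : cholR A n i l = 0 := by
  induction n generalizing i with
  | zero => omega
  | succ n ih =>
    rw [cholR]; split_ifs with hn
    · rcases Nat.lt_succ_iff_lt_or_eq.1 hl with h1 | h1
      · exact cholA_row_keep (cholR_psd h n) _ _ (fun i => ih h1 i) i
      · have : l = ⟨n, hn⟩ := Fin.ext h1
        subst this
        exact cholA_row (cholR_psd h n) _ i
    · exact ih (by omega) i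

lemma chol_sum_aux {d : ℕ} (A : Fin d → Fin d → ℝ) (n : ℕ) (hn : n ≤ d) (i j : Fin d) :
    A i j = cholR A n i j + ∑ k : Fin d, if (k : ℕ) < n then cholS A k i * cholS A k j else 0 := by
  induction n with
  | zero => simp [cholR]
  | succ n ih =>
    rw [ih (by omega), cholR, dif_pos (by omega : n < d)]
    have e : ∀ k : Fin d, (if (k : ℕ) < n + 1 then cholS A k i * cholS A k j else 0) =
      (if (k : ℕ) < n then cholS A k i * cholS A k j else 0) +
      (if k = ⟨n, by omega⟩ then cholS A k i * cholS A k j else 0) := by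
      intro k
      rcases lt_trichotomy (k : ℕ) n with h1 | h1 | h1
      · rw [if_pos (by omega), if_pos h1, if_neg (by intro h; simp [h] at h1)]; simp
      · have : k = ⟨n, by omega⟩ := Fin.ext h1
        rw [if_pos (by omega), if_neg (by omega), if_pos this]; simp
      · rw [if_neg (by omega), if_neg (by omega), if_neg (by intro h; simp [h] at h1)]; simp
    simp only [e, Finset.sum_add_distrib, Finset.sum_ite_eq', Finset.mem_univ, if_true]
    simp only [cholA, cholS]
    ring

lemma chol_sum {d : ℕ} {A : Fin d → Fin d → ℝ} (h : IsPSD A) (i j : Fin d) :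
    A i j = ∑ k : Fin d, cholS A k i * cholS A k j := by
  rw [chol_sum_aux A d le_rfl i j, cholR_zero h d j j.2, zero_add]
  exact Finset.sum_congr rfl fun k _ => by rw [if_pos k.2]

lemma chol_bound {d : ℕ} {A : Fin d → Fin d → ℝ} (h : IsPSD A) (i k : Fin d) :
    cholS A k i ^ 2 ≤ A i i := by
  rw [chol_sum h i i, sq]
  exact Finset.single_le_sum (f := fun k => cholS A k i * cholS A k i)
    (fun k _ => mul_self_nonneg _) (Finset.mem_univ k)

lemma cholR_measurable {d : ℕ} {A : ℝ → Fin d → Fin d → ℝ}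
    (hA : ∀ i j, Measurable fun r => A r i j) (n : ℕ) :
    ∀ i j, Measurable fun r => cholR (A r) n i j := by
  induction n with
  | zero => exact hA
  | succ n ih =>
    intro i j
    simp only [cholR]
    split_ifs with hn
    · unfold cholA cholV
      have := ih i j
      have h1 := ih i ⟨n, hn⟩
      have h2 := ih j ⟨n, hn⟩
      have h3 := ih ⟨n, hn⟩ ⟨n, hn⟩
      fun_prop
    · exact ih i j

lemma cholS_measurable {d : ℕ} {A : ℝ → Fin d → Fin d → ℝ}
    (hA : ∀ i j, Measurable fun r => A r i j) (k : Fin d) :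
    Measurable fun r => cholS (A r) k := by
  refine measurable_pi_lambda _ fun i => ?_
  unfold cholS cholV
  have h1 := cholR_measurable hA k i k
  have h3 := cholR_measurable hA k k k
  fun_prop

/-- Kinetic function. -/
noncomputable def chi (ξ u : ℝ) : ℝ :=
  (Set.Ioc 0 u).indicator (fun _ => (1 : ℝ)) ξ - (Set.Ioc u 0).indicator (fun _ => (1 : ℝ)) ξ

lemma chi_measurable : Measurable (fun p : ℝ × ℝ => chi p.1 p.2) := by
  have e : (fun p : ℝ × ℝ => chi p.1 p.2) = fun p : ℝ × ℝ =>
      ({p : ℝ × ℝ | 0 < p.1 ∧ p.1 ≤ p.2}).indicator (fun _ => (1:ℝ)) p -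
      ({p : ℝ × ℝ | p.2 < p.1 ∧ p.1 ≤ 0}).indicator (fun _ => (1:ℝ)) p := by
    ext p
    simp only [chi, Set.indicator, Set.mem_Ioc, Set.mem_ofPred_eq]
  rw [e]
  refine Measurable.sub ?_ ?_
  · refine measurable_const.indicator ?_
    exact (measurableSet_lt measurable_const measurable_fst).inter
      (measurableSet_le measurable_fst measurable_snd)
  · refine measurable_const.indicator ?_
    exact (measurableSet_lt measurable_snd measurable_fst).inter
      (measurableSet_le measurable_fst measurable_const)

lemma chi_zero (ξ : ℝ) : chi ξ 0 = 0 := by simp [chi]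

lemma chi_abs_sub (ξ u v : ℝ) :
    |chi ξ u - chi ξ v| = (Set.Ioc (min u v) (max u v)).indicator (fun _ => (1 : ℝ)) ξ := by
  simp only [chi, Set.indicator, Set.mem_Ioc, min_lt_iff, le_max_iff]
  split_ifs <;> first | (norm_num; done) | (exfalso; grind)

lemma lintegral_chi_sub (u v : ℝ) :
    ∫⁻ ξ, ‖chi ξ u - chi ξ v‖ₑ = ‖u - v‖ₑ := by
  have e : ∀ ξ, ‖chi ξ u - chi ξ v‖ₑ =
      (Set.Ioc (min u v) (max u v)).indicator (fun _ => (1 : ENNReal)) ξ := by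
    intro ξ
    rw [Real.enorm_eq_ofReal_abs, chi_abs_sub]
    by_cases h : ξ ∈ Set.Ioc (min u v) (max u v) <;> simp [h]
  simp only [e]
  rw [lintegral_indicator measurableSet_Ioc]
  simp only [lintegral_const, MeasurableSet.univ, Measure.restrict_apply, Set.univ_inter, one_mul,
    Real.volume_Ioc, max_sub_min_eq_abs', Real.enorm_eq_ofReal_abs]

lemma lintegral_chi (u : ℝ) : ∫⁻ ξ, ‖chi ξ u‖ₑ = ‖u‖ₑ := by
  simpa [chi_zero] using lintegral_chi_sub u 0

lemma chi_meas_left (u : ℝ) : Measurable fun ξ => chi ξ u :=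
  chi_measurable.comp (measurable_id.prodMk measurable_const)

lemma chi_integrable (u : ℝ) : Integrable fun ξ => chi ξ u := by
  refine ⟨(chi_meas_left u).aestronglyMeasurable, ?_⟩
  rw [hasFiniteIntegral_iff_enorm, lintegral_chi]
  exact enorm_lt_top

lemma integral_abs_chi (u : ℝ) : ∫ ξ, |chi ξ u| = |u| := by
  have := integral_norm_eq_lintegral_enorm (chi_meas_left u).aestronglyMeasurable
    (μ := volume)
  simp only [Real.norm_eq_abs] at this
  rw [this, lintegral_chi]
  simp

lemma chi_ne_zero {ξ u : ℝ} (h : chi ξ u ≠ 0) : |ξ| ≤ |u| := by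
  by_contra h2
  apply h
  simp only [chi, Set.indicator, Set.mem_Ioc]
  have h3 : ¬ (0 < ξ ∧ ξ ≤ u) := by
    rintro ⟨h4, h5⟩; apply h2; rw [abs_of_pos h4, abs_of_pos (h4.trans_le h5)]; exact h5
  have h4 : ¬ (u < ξ ∧ ξ ≤ 0) := by
    rintro ⟨h4, h5⟩; apply h2
    rw [abs_of_nonpos h5, abs_of_neg (h4.trans_le h5)]; linarith
  simp [h3, h4]

lemma integral_chi_mul (u : ℝ) (g : ℝ → ℝ) (hg : Continuous g) :
    ∫ ξ, chi ξ u * g ξ = ∫ ξ in (0:ℝ)..u, g ξ := by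
  have e : ∀ ξ, chi ξ u * g ξ =
      (Set.Ioc 0 u).indicator g ξ - (Set.Ioc u 0).indicator g ξ := by
    intro ξ
    simp only [chi, Set.indicator]
    split_ifs <;> ring
  simp only [e]
  rw [integral_sub, integral_indicator measurableSet_Ioc, integral_indicator measurableSet_Ioc,
    intervalIntegral]
  · rw [integrable_indicator_iff measurableSet_Ioc]
    exact (hg.integrableOn_Icc).mono_set Set.Ioc_subset_Icc_self
  · rw [integrable_indicator_iff measurableSet_Ioc]
    exact (hg.integrableOn_Icc).mono_set Set.Ioc_subset_Icc_self

lemma integral_chi (u : ℝ) : ∫ ξ, chi ξ u = u := by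
  have := integral_chi_mul u (fun _ => 1) continuous_const
  simpa using this

lemma chi_mul_integrable (u : ℝ) (g : ℝ → ℝ) (hg : Continuous g) :
    Integrable fun ξ => chi ξ u * g ξ := by
  have e : ∀ ξ, chi ξ u * g ξ =
      (Set.Ioc 0 u).indicator g ξ - (Set.Ioc u 0).indicator g ξ := by
    intro ξ
    simp only [chi, Set.indicator]
    split_ifs <;> ring
  simp only [e]
  refine Integrable.sub ?_ ?_
  · rw [integrable_indicator_iff measurableSet_Ioc]
    exact (hg.integrableOn_Icc).mono_set Set.Ioc_subset_Icc_self
  · rw [integrable_indicator_iff measurableSet_Ioc]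
    exact (hg.integrableOn_Icc).mono_set Set.Ioc_subset_Icc_self

lemma chi_le {ξ u M : ℝ} (h : |u| ≤ M) :
    chi ξ u ≤ (Set.Ioc 0 M).indicator (fun _ => (1 : ℝ)) ξ ∧
    -(Set.Ioc (-M) 0).indicator (fun _ => (1 : ℝ)) ξ ≤ chi ξ u := by
  rw [abs_le] at h
  simp only [chi, Set.indicator, Set.mem_Ioc]
  constructor <;> split_ifs <;> first | (norm_num; done) | (exfalso; grind)

lemma abs_integral_chi_le {M : ℝ} (hM : 0 ≤ M) (g : ℝ → ℝ) (hg : ∀ᵐ ξ, |g ξ| ≤ M)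
    (hi : Integrable fun ξ => chi ξ (g ξ)) : |∫ ξ, chi ξ (g ξ)| ≤ M := by
  have i1 : ∀ a b : ℝ, Integrable ((Set.Ioc a b).indicator (fun _ => (1 : ℝ))) := by
    intro a b
    rw [integrable_indicator_iff measurableSet_Ioc]
    exact integrableOn_const (by simp)
  have v1 : ∀ a b : ℝ, a ≤ b → ∫ ξ, (Set.Ioc a b).indicator (fun _ => (1 : ℝ)) ξ = b - a := by
    intro a b hab
    rw [integral_indicator measurableSet_Ioc]
    simp [hab]
  rw [abs_le]
  constructor
  · have := integral_mono_ae (i1 (-M) 0).neg hi (by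
      filter_upwards [hg] with ξ h using (chi_le h).2)
    simp only [Pi.neg_apply, integral_neg] at this
    rw [v1 _ _ (by linarith)] at this
    linarith
  · have := integral_mono_ae hi (i1 0 M) (by
      filter_upwards [hg] with ξ h using (chi_le h).1)
    rw [v1 _ _ hM] at this
    linarith

section kernel
variable {d : ℕ}

lemma shear_mp {y : ℝ → (Fin d → ℝ)} (hy : Measurable y) :
    MeasurePreserving (fun p : ℝ × (Fin d → ℝ) => (p.1, p.2 - y p.1))
      ((volume : Measure ℝ).prod volume) ((volume : Measure ℝ).prod volume) := by
  refine MeasurePreserving.skew_product (MeasurePreserving.id _)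
    (g := fun ξ x => x - y ξ) ?_ ?_
  · simp only [Function.uncurry_def]; fun_prop
  · exact ae_of_all _ fun ξ => map_sub_right_eq_self _ _

lemma G_meas {f : (Fin d → ℝ) → ℝ} (hf : Measurable f) :
    Measurable fun p : ℝ × (Fin d → ℝ) => chi p.1 (f p.2) :=
  chi_measurable.comp (measurable_fst.prodMk (hf.comp measurable_snd))

lemma G_int {f : (Fin d → ℝ) → ℝ} (hf : Measurable f) (hi : Integrable f) :
    Integrable (fun p : ℝ × (Fin d → ℝ) => chi p.1 (f p.2))
      ((volume : Measure ℝ).prod volume) := by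
  refine ⟨(G_meas hf).aestronglyMeasurable, ?_⟩
  rw [hasFiniteIntegral_iff_enorm,
    lintegral_prod_symm _ ((G_meas hf).enorm.aemeasurable)]
  simp only [lintegral_chi]
  exact hi.2

/-- Transport-collapse along `y`. -/
noncomputable def Kfun (y : ℝ → (Fin d → ℝ)) (f : (Fin d → ℝ) → ℝ) (x : Fin d → ℝ) : ℝ :=
  ∫ ξ, chi ξ (f (x - y ξ))

lemma Gs_int {y : ℝ → (Fin d → ℝ)} (hy : Measurable y) {f : (Fin d → ℝ) → ℝ}
    (hf : Measurable f) (hi : Integrable f) :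
    Integrable (fun p : ℝ × (Fin d → ℝ) => chi p.1 (f (p.2 - y p.1)))
      ((volume : Measure ℝ).prod volume) :=
  (shear_mp hy).integrable_comp_of_integrable (G_int hf hi)

lemma Kfun_int {y : ℝ → (Fin d → ℝ)} (hy : Measurable y) {f : (Fin d → ℝ) → ℝ}
    (hf : Measurable f) (hi : Integrable f) : Integrable (Kfun y f) :=
  (Gs_int hy hf hi).integral_prod_right

lemma Kfun_contr {y : ℝ → (Fin d → ℝ)} (hy : Measurable y) {f g : (Fin d → ℝ) → ℝ}
    (hf : Measurable f) (hi : Integrable f) (hg : Measurable g) (hgi : Integrable g) :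
    ∫⁻ x, ‖Kfun y f x - Kfun y g x‖ₑ ≤ ∫⁻ x, ‖f x - g x‖ₑ := by
  have hm : Measurable fun p : ℝ × (Fin d → ℝ) => ‖chi p.1 (f p.2) - chi p.1 (g p.2)‖ₑ :=
    ((G_meas hf).sub (G_meas hg)).enorm
  calc ∫⁻ x, ‖Kfun y f x - Kfun y g x‖ₑ
      ≤ ∫⁻ x, ∫⁻ ξ, ‖chi ξ (f (x - y ξ)) - chi ξ (g (x - y ξ))‖ₑ := by
        refine lintegral_mono_ae ?_
        filter_upwards [(Gs_int hy hf hi).prod_left_ae, (Gs_int hy hg hgi).prod_left_ae]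
          with x h1 h2
        rw [Kfun, Kfun, ← integral_sub h1 h2]
        exact enorm_integral_le_lintegral_enorm _
    _ = ∫⁻ p, ‖chi p.1 (f (p.2 - y p.1)) - chi p.1 (g (p.2 - y p.1))‖ₑ
          ∂((volume : Measure ℝ).prod (volume : Measure (Fin d → ℝ))) := by
        rw [lintegral_prod_symm]
        exact (hm.comp (shear_mp hy).measurable).aemeasurable
    _ = ∫⁻ p, ‖chi p.1 (f p.2) - chi p.1 (g p.2)‖ₑ
          ∂((volume : Measure ℝ).prod (volume : Measure (Fin d → ℝ))) :=
        (shear_mp hy).lintegral_comp hm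
    _ = ∫⁻ x, ‖f x - g x‖ₑ := by
        rw [lintegral_prod_symm _ hm.aemeasurable]
        simp only [lintegral_chi_sub]

lemma Kfun_bdd {y : ℝ → (Fin d → ℝ)} (hy : Measurable y) {f : (Fin d → ℝ) → ℝ}
    (hf : Measurable f) (hi : Integrable f) {M : ℝ} (hM : 0 ≤ M) (hb : ∀ᵐ x, |f x| ≤ M) :
    ∀ᵐ x, |Kfun y f x| ≤ M := by
  have h1 : ∀ᵐ p ∂((volume : Measure ℝ).prod (volume : Measure (Fin d → ℝ))),
      |f p.2| ≤ M := Measure.quasiMeasurePreserving_snd.ae hb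
  have h2 := (shear_mp hy).quasiMeasurePreserving.ae h1
  have h3 := (Measure.measurePreserving_swap (μ := (volume : Measure (Fin d → ℝ)))
    (ν := (volume : Measure ℝ))).quasiMeasurePreserving.ae h2
  have h4 := Measure.ae_ae_of_ae_prod h3
  filter_upwards [h4, (Gs_int hy hf hi).prod_left_ae] with x hx hx2
  exact abs_integral_chi_le hM (fun ξ => f (x - y ξ)) hx hx2

lemma kin_int {y : ℝ → (Fin d → ℝ)} (hy : Measurable y) {G : ℝ × (Fin d → ℝ) → ℝ}
    (hG : Integrable G ((volume : Measure ℝ).prod volume))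
    {ψ : (Fin d → ℝ) → ℝ} (hψ : Continuous ψ) {C : ℝ} (hC : ∀ x, |ψ x| ≤ C) :
    Integrable (fun p : ℝ × (Fin d → ℝ) => G p * ψ (p.2 + y p.1))
      ((volume : Measure ℝ).prod volume) := by
  refine hG.mul_bdd (c := C) ?_ (ae_of_all _ fun p => hC _)
  exact (hψ.measurable.comp
    (measurable_snd.add (hy.comp measurable_fst))).aestronglyMeasurable

/-- duality on the kinetic level -/
lemma kin_dual {y : ℝ → (Fin d → ℝ)} (hy : Measurable y) {G : ℝ × (Fin d → ℝ) → ℝ}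
    (hG : Integrable G ((volume : Measure ℝ).prod volume))
    {ψ : (Fin d → ℝ) → ℝ} (hψ : Continuous ψ) {C : ℝ} (hC : ∀ x, |ψ x| ≤ C) :
    ∫ x, (∫ ξ, G (ξ, x - y ξ)) * ψ x =
      ∫ p, G p * ψ (p.2 + y p.1) ∂((volume : Measure ℝ).prod (volume : Measure (Fin d → ℝ))) := by
  have i1 := kin_int hy hG hψ hC
  have i2 := (shear_mp hy).integrable_comp_of_integrable i1
  let Φ : (ℝ × (Fin d → ℝ)) ≃ᵐ (ℝ × (Fin d → ℝ)) :=
    { toFun := fun p => (p.1, p.2 - y p.1)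
      invFun := fun p => (p.1, p.2 + y p.1)
      left_inv := fun p => by simp
      right_inv := fun p => by simp
      measurable_toFun := (shear_mp hy).measurable
      measurable_invFun :=
        measurable_fst.prodMk (measurable_snd.add (hy.comp measurable_fst)) }
  have e : ∫ p, ((fun p => G p * ψ (p.2 + y p.1)) ∘ fun p => (p.1, p.2 - y p.1)) p
      ∂((volume : Measure ℝ).prod (volume : Measure (Fin d → ℝ))) = _ :=
    MeasurePreserving.integral_comp' (f := Φ) (shear_mp hy) (fun p => G p * ψ (p.2 + y p.1))
  rw [integral_prod_symm _ i2] at e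
  simp only [Function.comp, sub_add_cancel] at e
  rw [← e]
  simp only [integral_mul_const]

end kernel

set_option linter.unusedSectionVars false

/-- `L¹(ℝ^d)` -/
noncomputable abbrev L1d (d : ℕ) := Lp ℝ 1 (volume : Measure (Fin d → ℝ))

section ops
variable {d : ℕ}

lemma L1d_meas (u : L1d d) : Measurable (u : (Fin d → ℝ) → ℝ) := (Lp.stronglyMeasurable u).measurable

lemma L1d_int (u : L1d d) : Integrable (u : (Fin d → ℝ) → ℝ) := L1.integrable_coeFn u

lemma L1d_enorm_sub (u v : L1d d) : ‖u - v‖ₑ = ∫⁻ x, ‖u x - v x‖ₑ := by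
  rw [Lp.enorm_def, eLpNorm_one_eq_lintegral_enorm]
  refine lintegral_congr_ae ?_
  filter_upwards [Lp.coeFn_sub u v] with x hx
  rw [hx, Pi.sub_apply]

lemma L1d_norm (u : L1d d) : ‖u‖ = ∫ x, |u x| := L1.norm_eq_integral_norm u

lemma L1d_norm_sub (u v : L1d d) : ‖u - v‖ = ∫ x, |u x - v x| := by
  rw [L1d_norm]
  refine integral_congr_ae ?_
  filter_upwards [Lp.coeFn_sub u v] with x hx
  rw [hx, Pi.sub_apply]

/-- The transport-collapse operator on `L¹`. -/
noncomputable def Kop (y : ℝ → (Fin d → ℝ)) (hy : Measurable y) (u : L1d d) : L1d d :=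
  (Kfun_int hy (L1d_meas u) (L1d_int u)).toL1 (Kfun y u)

lemma Kop_coe {y : ℝ → (Fin d → ℝ)} (hy : Measurable y) (u : L1d d) :
    Kop y hy u =ᵐ[volume] Kfun y u := Integrable.coeFn_toL1 _

lemma Kop_contr {y : ℝ → (Fin d → ℝ)} (hy : Measurable y) (u v : L1d d) :
    ‖Kop y hy u - Kop y hy v‖ ≤ ‖u - v‖ := by
  have h : ‖Kop y hy u - Kop y hy v‖ₑ ≤ ‖u - v‖ₑ := by
    rw [L1d_enorm_sub, L1d_enorm_sub]
    refine le_trans (le_of_eq ?_)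
      (Kfun_contr hy (L1d_meas u) (L1d_int u) (L1d_meas v) (L1d_int v))
    refine lintegral_congr_ae ?_
    filter_upwards [Kop_coe hy u, Kop_coe hy v] with x h1 h2
    rw [h1, h2]
  simpa [← ofReal_norm, ENNReal.ofReal_le_ofReal_iff] using h

lemma Kfun_congr {y : ℝ → (Fin d → ℝ)} (hy : Measurable y) {f g : (Fin d → ℝ) → ℝ}
    (hf : Measurable f) (hi : Integrable f) (hg : Measurable g) (hgi : Integrable g)
    (h : f =ᵐ[volume] g) : Kfun y f =ᵐ[volume] Kfun y g := by
  have h1 := Kfun_contr hy hf hi hg hgi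
  have h2 : ∫⁻ x, ‖f x - g x‖ₑ = 0 := by
    rw [lintegral_congr_ae (g := fun _ => 0)]
    · simp
    · filter_upwards [h] with x hx
      simp [hx]
  rw [h2, nonpos_iff_eq_zero, lintegral_eq_zero_iff'] at h1
  · filter_upwards [h1] with x hx
    simpa [sub_eq_zero] using hx
  · exact ((Kfun_int hy hf hi).aestronglyMeasurable.sub
      (Kfun_int hy hg hgi).aestronglyMeasurable).enorm

/-- Translation on `L¹`. -/
noncomputable def tau (z : Fin d → ℝ) (u : L1d d) : L1d d :=
  Lp.compMeasurePreserving (· + z) (measurePreserving_add_right volume z) u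

lemma tau_coe (z : Fin d → ℝ) (u : L1d d) : tau z u =ᵐ[volume] fun x => u (x + z) :=
  Lp.coeFn_compMeasurePreserving u _

lemma tau_sub (z : Fin d → ℝ) (u v : L1d d) : tau z (u - v) = tau z u - tau z v := map_sub _ _ _

lemma tau_tendsto (u : L1d d) : Tendsto (fun z => tau z u) (nhds 0) (nhds u) := by
  have h : Continuous fun z : Fin d → ℝ =>
      Lp.compMeasurePreserving (E := ℝ) (p := 1)
        ((⟨fun x => x + z, by fun_prop⟩ : C(Fin d → ℝ, Fin d → ℝ)))
        (measurePreserving_add_right volume z) u := by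
    refine Continuous.compMeasurePreservingLp (f := fun _ : Fin d → ℝ => u)
      (g := fun z : Fin d → ℝ => (⟨fun x => x + z, by fun_prop⟩ : C(Fin d → ℝ, Fin d → ℝ)))
      continuous_const ?_ (fun z => measurePreserving_add_right volume z) (by simp)
    refine ContinuousMap.continuous_of_continuous_uncurry _ ?_
    simp only [Function.uncurry_def, ContinuousMap.coe_mk]
    fun_prop
  have h0 : tau 0 u = u := by
    apply Lp.ext
    filter_upwards [tau_coe 0 u] with x hx
    rw [hx, add_zero]
  have := h.tendsto 0
  change Tendsto (fun z => tau z u) (nhds 0) (nhds (tau 0 u)) at this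
  rwa [h0] at this

lemma Kop_tau {y : ℝ → (Fin d → ℝ)} (hy : Measurable y) (z : Fin d → ℝ) (u : L1d d) :
    Kop y hy (tau z u) = tau z (Kop y hy u) := by
  apply Lp.ext
  have mp := measurePreserving_add_right (volume : Measure (Fin d → ℝ)) z
  have h1 : Kfun y (tau z u) =ᵐ[volume] Kfun y (fun x => u (x + z)) :=
    Kfun_congr hy (L1d_meas _) (L1d_int _) ((L1d_meas u).comp (measurable_add_const z))
      (mp.integrable_comp_of_integrable (L1d_int u)) (tau_coe z u)
  have h2 := mp.quasiMeasurePreserving.ae (Kop_coe hy u)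
  filter_upwards [Kop_coe hy (tau z u), tau_coe z (Kop y hy u), h1, h2] with x e1 e2 e3 e4
  rw [e1, e2, e3, e4]
  simp only [Kfun]
  refine integral_congr_ae (ae_of_all _ fun ξ => ?_)
  simp only
  rw [sub_add_eq_add_sub]

/-- a.e. bound -/
def Bd (M : ℝ) (u : L1d d) : Prop := ∀ᵐ x, |u x| ≤ M

lemma Kop_Bd {y : ℝ → (Fin d → ℝ)} (hy : Measurable y) {M : ℝ} (hM : 0 ≤ M) {u : L1d d}
    (h : Bd M u) : Bd M (Kop y hy u) := by
  unfold Bd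
  filter_upwards [Kop_coe hy u, Kfun_bdd hy (L1d_meas u) (L1d_int u) hM h] with x h1 h2
  rwa [h1]

/-- the measure on the kinetic space -/
noncomputable abbrev kinM (d : ℕ) : Measure (ℝ × (Fin d → ℝ)) :=
  (volume : Measure ℝ).prod (volume : Measure (Fin d → ℝ))

noncomputable abbrev ch (u : L1d d) (p : ℝ × (Fin d → ℝ)) : ℝ := chi p.1 (u p.2)

lemma ch_int (u : L1d d) : Integrable (ch u) (kinM d) := G_int (L1d_meas u) (L1d_int u)

lemma ch_norm (u : L1d d) : ∫ p, |ch u p| ∂(kinM d) = ‖u‖ := by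
  rw [integral_prod_symm _ (ch_int u).abs, L1d_norm]
  simp only [ch, integral_abs_chi]

lemma Kop_dual {y : ℝ → (Fin d → ℝ)} (hy : Measurable y) (u : L1d d)
    {ψ : (Fin d → ℝ) → ℝ} (hψ : Continuous ψ) {C : ℝ} (hC : ∀ x, |ψ x| ≤ C) :
    ∫ x, Kop y hy u x * ψ x = ∫ p, ch u p * ψ (p.2 + y p.1) ∂(kinM d) := by
  rw [← kin_dual hy (ch_int u) hψ hC]
  refine integral_congr_ae ?_
  filter_upwards [Kop_coe hy u] with x hx
  rw [hx]; rfl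

lemma Kop_abs {y : ℝ → (Fin d → ℝ)} (hy : Measurable y) (u : L1d d)
    {ψ : (Fin d → ℝ) → ℝ} (hψ : Continuous ψ) {C : ℝ} (hC : ∀ x, |ψ x| ≤ C)
    (h0 : ∀ x, 0 ≤ ψ x) :
    ∫ x, |Kop y hy u x| * ψ x ≤ ∫ p, |ch u p| * ψ (p.2 + y p.1) ∂(kinM d) := by
  rw [← kin_dual hy (ch_int u).abs hψ hC]
  have i1 : Integrable fun x => |Kop y hy u x| * ψ x :=
    (L1d_int _).abs.mul_bdd (c := C) hψ.aestronglyMeasurable (ae_of_all _ hC)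
  have i2 : Integrable fun x => (∫ ξ, |ch u (ξ, x - y ξ)|) * ψ x := by
    refine Integrable.mul_bdd (c := C) ?_ hψ.aestronglyMeasurable (ae_of_all _ hC)
    exact (Gs_int hy (L1d_meas u) (L1d_int u)).abs.integral_prod_right
  refine integral_mono_ae i1 i2 ?_
  filter_upwards [Kop_coe hy u] with x hx
  rw [hx]
  refine mul_le_mul_of_nonneg_right ?_ (h0 x)
  exact abs_integral_le_integral_abs

lemma u_dual (u : L1d d) {ψ : (Fin d → ℝ) → ℝ} (hψ : Continuous ψ) {C : ℝ}
    (hC : ∀ x, |ψ x| ≤ C) : ∫ x, u x * ψ x = ∫ p, ch u p * ψ p.2 ∂(kinM d) := by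
  have := kin_int (measurable_const (a := (0 : Fin d → ℝ))) (ch_int u) hψ hC
  simp only [add_zero] at this
  rw [integral_prod_symm _ this]
  simp only [ch, integral_mul_const, integral_chi]

lemma u_abs (u : L1d d) {ψ : (Fin d → ℝ) → ℝ} (hψ : Continuous ψ) {C : ℝ}
    (hC : ∀ x, |ψ x| ≤ C) : ∫ x, |u x| * ψ x = ∫ p, |ch u p| * ψ p.2 ∂(kinM d) := by
  have := kin_int (measurable_const (a := (0 : Fin d → ℝ))) (ch_int u).abs hψ hC
  simp only [add_zero] at this
  rw [integral_prod_symm _ this]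
  simp only [ch, integral_mul_const, integral_abs_chi]

lemma ch_bd {M : ℝ} {u : L1d d} (h : Bd M u) : ∀ᵐ p ∂(kinM d), ch u p ≠ 0 → |p.1| ≤ M := by
  have h1 : ∀ᵐ p ∂(kinM d), |u p.2| ≤ M := Measure.quasiMeasurePreserving_snd.ae h
  filter_upwards [h1] with p hp h2
  exact (chi_ne_zero h2).trans hp

/-- Main bound on kinetic integrals. -/
lemma kin_bound {M C : ℝ} {u : L1d d} (h : Bd M u) {g : ℝ × (Fin d → ℝ) → ℝ}
    (hg : ∀ p, |p.1| ≤ M → |g p| ≤ C) : |∫ p, ch u p * g p ∂(kinM d)| ≤ C * ‖u‖ := by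
  rw [← ch_norm u, ← integral_const_mul, ← Real.norm_eq_abs]
  refine norm_integral_le_of_norm_le ((ch_int u).abs.const_mul C) ?_
  filter_upwards [ch_bd h] with p hp
  rw [Real.norm_eq_abs, abs_mul, mul_comm]
  by_cases h0 : ch u p = 0
  · simp [h0]
  · exact mul_le_mul_of_nonneg_right (hg p (hp h0)) (abs_nonneg _)

lemma kin_bound_abs {M C : ℝ} {u : L1d d} (h : Bd M u) {g : ℝ × (Fin d → ℝ) → ℝ}
    (hg : ∀ p, |p.1| ≤ M → |g p| ≤ C) : |∫ p, |ch u p| * g p ∂(kinM d)| ≤ C * ‖u‖ := by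
  rw [← ch_norm u, ← integral_const_mul, ← Real.norm_eq_abs]
  refine norm_integral_le_of_norm_le ((ch_int u).abs.const_mul C) ?_
  filter_upwards [ch_bd h] with p hp
  rw [Real.norm_eq_abs, abs_mul, mul_comm, abs_abs]
  by_cases h0 : ch u p = 0
  · simp [h0]
  · exact mul_le_mul_of_nonneg_right (hg p (hp h0)) (abs_nonneg _)

lemma kin_integrable {M C : ℝ} {u : L1d d} (h : Bd M u) {g : ℝ × (Fin d → ℝ) → ℝ}
    (hm : Measurable g)
    (hg : ∀ p, |p.1| ≤ M → |g p| ≤ C) : Integrable (fun p => ch u p * g p) (kinM d) := by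
  refine ((ch_int u).abs.const_mul C).mono'
    ((G_meas (L1d_meas u)).mul hm).aestronglyMeasurable ?_
  filter_upwards [ch_bd h] with p hp
  rw [Real.norm_eq_abs, abs_mul, mul_comm]
  by_cases h0 : ch u p = 0
  · simp [h0]
  · exact mul_le_mul_of_nonneg_right (hg p (hp h0)) (abs_nonneg _)

/-- Averaged operator. -/
noncomputable def Tavg {ι : Type} [Fintype ι] (Y : ι → ℝ → (Fin d → ℝ))
    (hY : ∀ m, Measurable (Y m)) (u : L1d d) : L1d d :=
  (Fintype.card ι : ℝ)⁻¹ • ∑ m, Kop (Y m) (hY m) u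

variable {ι : Type} [Fintype ι] [Nonempty ι] (Y : ι → ℝ → (Fin d → ℝ))
    (hY : ∀ m, Measurable (Y m))

lemma Tavg_coe (u : L1d d) : Tavg Y hY u =ᵐ[volume] fun x =>
    (Fintype.card ι : ℝ)⁻¹ * ∑ m, Kop (Y m) (hY m) u x := by
  unfold Tavg
  have h : ∀ s : Finset ι, (∑ m ∈ s, Kop (Y m) (hY m) u : L1d d) =ᵐ[volume]
      fun x => ∑ m ∈ s, Kop (Y m) (hY m) u x := by
    intro s
    classical
    induction s using Finset.induction_on with
    | empty => simp only [Finset.sum_empty]; exact Lp.coeFn_zero _ _ _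
    | insert a s ha ih =>
      simp only [Finset.sum_insert ha]
      filter_upwards [Lp.coeFn_add (Kop (Y a) (hY a) u) (∑ m ∈ s, Kop (Y m) (hY m) u), ih]
        with x h1 h2
      rw [h1, Pi.add_apply, h2]
  filter_upwards [Lp.coeFn_smul (Fintype.card ι : ℝ)⁻¹ (∑ m, Kop (Y m) (hY m) u),
    h Finset.univ] with x h1 h2
  rw [h1, Pi.smul_apply, h2, smul_eq_mul]

lemma avg_le {g : ι → ℝ} {C : ℝ} (h : ∀ m, g m ≤ C) :
    (Fintype.card ι : ℝ)⁻¹ * ∑ m, g m ≤ C := by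
  have hc : (0:ℝ) < Fintype.card ι := by exact_mod_cast Fintype.card_pos
  rw [inv_mul_le_iff₀ hc]
  calc ∑ m, g m ≤ ∑ _m : ι, C := Finset.sum_le_sum fun m _ => h m
    _ = _ := by simp

lemma avg_abs_le {g : ι → ℝ} {C : ℝ} (h : ∀ m, |g m| ≤ C) :
    |(Fintype.card ι : ℝ)⁻¹ * ∑ m, g m| ≤ C := by
  have hc : (0:ℝ) < Fintype.card ι := by exact_mod_cast Fintype.card_pos
  rw [abs_mul, abs_of_pos (inv_pos.2 hc)]
  refine le_trans ?_ (avg_le h)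
  gcongr
  exact Finset.abs_sum_le_sum_abs _ _

lemma avg_const (c : ℝ) : (Fintype.card ι : ℝ)⁻¹ * ∑ _m : ι, c = c := by
  have hc : (0:ℝ) < Fintype.card ι := by exact_mod_cast Fintype.card_pos
  simp only [Finset.sum_const, Finset.card_univ, nsmul_eq_mul]
  field_simp

lemma Tavg_contr (u v : L1d d) : ‖Tavg Y hY u - Tavg Y hY v‖ ≤ ‖u - v‖ := by
  have hc : (0:ℝ) < Fintype.card ι := by exact_mod_cast Fintype.card_pos
  rw [Tavg, Tavg, ← smul_sub, ← Finset.sum_sub_distrib, norm_smul, Real.norm_eq_abs,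
    abs_of_pos (inv_pos.2 hc)]
  refine le_trans ?_ (avg_le (ι := ι) (g := fun m => ‖Kop (Y m) (hY m) u - Kop (Y m) (hY m) v‖)
    (fun m => Kop_contr (hY m) u v))
  gcongr
  exact norm_sum_le _ _

lemma Tavg_tau (z : Fin d → ℝ) (u : L1d d) : Tavg Y hY (tau z u) = tau z (Tavg Y hY u) := by
  simp only [Tavg, Kop_tau]
  have := map_smul (Lp.compMeasurePreservingₗ (E := ℝ) (p := 1) ℝ (· + z)
    (measurePreserving_add_right (volume : Measure (Fin d → ℝ)) z))
    (Fintype.card ι : ℝ)⁻¹ (∑ m, Kop (Y m) (hY m) u)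
  rw [map_sum] at this
  exact this.symm

lemma Tavg_Bd {M : ℝ} (hM : 0 ≤ M) {u : L1d d} (h : Bd M u) : Bd M (Tavg Y hY u) := by
  have h1 : ∀ᵐ x, ∀ m, |Kop (Y m) (hY m) u x| ≤ M :=
    ae_all_iff.2 fun m => Kop_Bd (hY m) hM h
  unfold Bd
  filter_upwards [Tavg_coe Y hY u, h1] with x e1 e2
  rw [e1]
  exact avg_abs_le e2

lemma Tavg_zero : Tavg Y hY (0 : L1d d) = 0 := by
  have : ∀ m, Kop (Y m) (hY m) (0 : L1d d) = 0 := by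
    intro m
    apply Lp.ext
    have h0 : Kfun (Y m) ((0 : L1d d) : (Fin d → ℝ) → ℝ) =ᵐ[volume] Kfun (Y m) (fun _ => 0) :=
      Kfun_congr (hY m) (L1d_meas _) (L1d_int _) measurable_const (integrable_zero _ _ _)
        (Lp.coeFn_zero _ _ _)
    filter_upwards [Kop_coe (hY m) (0 : L1d d), h0, Lp.coeFn_zero ℝ 1
      (volume : Measure (Fin d → ℝ))] with x e1 e2 e3
    rw [e1, e2, e3]
    simp [Kfun, chi_zero]
  simp [Tavg, this]

lemma Tavg_norm (u : L1d d) : ‖Tavg Y hY u‖ ≤ ‖u‖ := by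
  have := Tavg_contr Y hY u 0
  simpa [Tavg_zero] using this

/-- Averaged test function -/
noncomputable def Eavg (ψ : (Fin d → ℝ) → ℝ) (p : ℝ × (Fin d → ℝ)) : ℝ :=
  (Fintype.card ι : ℝ)⁻¹ * ∑ m, ψ (p.2 + Y m p.1)

lemma Tavg_dual (u : L1d d) {ψ : (Fin d → ℝ) → ℝ} (hψ : Continuous ψ) {C : ℝ}
    (hC : ∀ x, |ψ x| ≤ C) :
    Integrable (fun p => ch u p * Eavg Y ψ p) (kinM d) ∧
    Integrable (fun p => |ch u p| * Eavg Y ψ p) (kinM d) ∧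
    ∫ x, Tavg Y hY u x * ψ x = ∫ p, ch u p * Eavg Y ψ p ∂(kinM d) ∧
    ((∀ x, 0 ≤ ψ x) →
      ∫ x, |Tavg Y hY u x| * ψ x ≤ ∫ p, |ch u p| * Eavg Y ψ p ∂(kinM d)) := by
  have e : ∀ c : ℝ × (Fin d → ℝ) → ℝ, (fun p => c p * Eavg Y ψ p) = fun p =>
      (Fintype.card ι : ℝ)⁻¹ * ∑ m, c p * ψ (p.2 + Y m p.1) := by
    intro c; ext p; rw [Eavg, ← Finset.mul_sum]; ring
  have i1 := fun m => kin_int (hY m) (ch_int u) hψ hC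
  have i2 := fun m => kin_int (hY m) (ch_int u).abs hψ hC
  have j1 : ∀ m, Integrable fun x => Kop (Y m) (hY m) u x * ψ x := fun m =>
    (L1d_int _).mul_bdd (c := C) hψ.aestronglyMeasurable (ae_of_all _ hC)
  have j2 : ∀ m, Integrable fun x => |Kop (Y m) (hY m) u x| * ψ x := fun m =>
    (L1d_int _).abs.mul_bdd (c := C) hψ.aestronglyMeasurable (ae_of_all _ hC)
  refine ⟨?_, ?_, ?_, ?_⟩
  · rw [e]; exact (integrable_finsetSum _ fun m _ => i1 m).const_mul _
  · rw [e]; exact (integrable_finsetSum _ fun m _ => i2 m).const_mul _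
  · rw [e, integral_const_mul, integral_finsetSum _ fun m _ => i1 m]
    simp only [← Kop_dual (hY _) u hψ hC]
    rw [← integral_finsetSum _ fun m _ => j1 m, ← integral_const_mul]
    refine integral_congr_ae ?_
    filter_upwards [Tavg_coe Y hY u] with x hx
    rw [hx, mul_assoc, Finset.sum_mul]
  · intro h0
    rw [e, integral_const_mul, integral_finsetSum _ fun m _ => i2 m]
    refine le_trans ?_ (mul_le_mul_of_nonneg_left
      (Finset.sum_le_sum fun m _ => Kop_abs (hY m) u hψ hC h0) (by positivity))
    rw [← integral_finsetSum _ fun m _ => j2 m, ← integral_const_mul]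
    refine integral_mono_ae ((L1d_int _).abs.mul_bdd (c := C) hψ.aestronglyMeasurable
      (ae_of_all _ hC)) ((integrable_finsetSum _ fun m _ => j2 m).const_mul _) ?_
    filter_upwards [Tavg_coe Y hY u] with x hx
    rw [hx, abs_mul, abs_of_nonneg (by positivity : (0:ℝ) ≤ (Fintype.card ι : ℝ)⁻¹), mul_assoc,
      ← Finset.sum_mul]
    gcongr
    · exact h0 x
    · exact Finset.abs_sum_le_sum_abs _ _

end ops

section KR
variable {d : ℕ}

/-- local average -/
noncomputable def lavg (B : Set (Fin d → ℝ)) (f : L1d d) (x : Fin d → ℝ) : ℝ :=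
  (volume.real B)⁻¹ * ∫ z in B, f (x + z)

lemma lavg_int (f : L1d d) (x : Fin d → ℝ) : Integrable fun z => f (x + z) :=
  (L1d_int f).comp_add_left x

lemma lavg_bound (B : Set (Fin d → ℝ)) (f : L1d d) (x : Fin d → ℝ) :
    |lavg B f x| ≤ (volume.real B)⁻¹ * ‖f‖ := by
  rw [lavg, abs_mul, abs_of_nonneg (by positivity : 0 ≤ (volume.real B)⁻¹), L1d_norm]
  gcongr
  refine abs_integral_le_integral_abs.trans ?_
  refine (setIntegral_le_integral (lavg_int f x).abs (ae_of_all _ fun _ => abs_nonneg _)).trans ?_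
  rw [integral_add_left_eq_self (fun z => |f z|) x]

lemma lavg_sub (B : Set (Fin d → ℝ)) (f : L1d d) (x x' : Fin d → ℝ) :
    |lavg B f x - lavg B f x'| ≤ (volume.real B)⁻¹ * ‖tau (x - x') f - f‖ := by
  rw [lavg, lavg, ← mul_sub, abs_mul, abs_of_nonneg (by positivity : 0 ≤ (volume.real B)⁻¹),
    L1d_norm_sub, ← integral_sub (lavg_int f x).integrableOn (lavg_int f x').integrableOn]
  gcongr
  refine abs_integral_le_integral_abs.trans ?_
  refine (setIntegral_le_integral ((lavg_int f x).sub (lavg_int f x')).abs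
    (ae_of_all _ fun _ => abs_nonneg _)).trans (le_of_eq ?_)
  rw [← integral_add_left_eq_self (fun z => |(tau (x - x') f) z - f z|) x']
  refine integral_congr_ae ?_
  have h := (measurePreserving_add_left (volume : Measure (Fin d → ℝ))
    x').quasiMeasurePreserving.ae (tau_coe (x - x') f)
  filter_upwards [h] with z hz
  have e : x' + z + (x - x') = x + z := by abel
  simp only [hz, e, Pi.sub_apply]

lemma lavg_approx {B : Set (Fin d → ℝ)} (hBm : MeasurableSet B) (hB : volume B ≠ ⊤)
    (hB0 : volume B ≠ 0) (f : L1d d) {ε : ℝ}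
    (hε : 0 ≤ ε) (h : ∀ z ∈ B, ‖tau z f - f‖ ≤ ε) :
    ∫⁻ x, ‖f x - lavg B f x‖ₑ ≤ ENNReal.ofReal ε := by
  have hV : 0 < volume.real B := ENNReal.toReal_pos hB0 hB
  have m1 : Measurable fun p : (Fin d → ℝ) × (Fin d → ℝ) => ‖f p.1 - f (p.1 + p.2)‖ₑ :=
    (((L1d_meas f).comp measurable_fst).sub
      ((L1d_meas f).comp (measurable_fst.add measurable_snd))).enorm
  have h1 : ∀ x, ‖f x - lavg B f x‖ₑ ≤
      ENNReal.ofReal (volume.real B)⁻¹ * ∫⁻ z in B, ‖f x - f (x + z)‖ₑ := by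
    intro x
    have e : f x - lavg B f x = (volume.real B)⁻¹ * ∫ z in B, (f x - f (x + z)) := by
      have ic : Integrable (fun _ : Fin d → ℝ => f x) (volume.restrict B) :=
        integrableOn_const hB
      have ic2 : Integrable (fun z : Fin d → ℝ => f (x + z)) (volume.restrict B) :=
        (lavg_int f x).integrableOn
      rw [integral_sub ic ic2, mul_sub, lavg]
      congr 1
      simp only [integral_const, smul_eq_mul, MeasurableSet.univ, measureReal_restrict_apply,
        Set.univ_inter]
      field_simp
    rw [e, enorm_mul, Real.enorm_eq_ofReal (by positivity)]
    gcongr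
    exact enorm_integral_le_lintegral_enorm _
  calc ∫⁻ x, ‖f x - lavg B f x‖ₑ
      ≤ ∫⁻ x, ENNReal.ofReal (volume.real B)⁻¹ * ∫⁻ z in B, ‖f x - f (x + z)‖ₑ :=
        lintegral_mono h1
    _ = ENNReal.ofReal (volume.real B)⁻¹ * ∫⁻ x, ∫⁻ z in B, ‖f x - f (x + z)‖ₑ := by
        rw [lintegral_const_mul' _ _ (by simp)]
    _ = ENNReal.ofReal (volume.real B)⁻¹ * ∫⁻ z in B, ∫⁻ x, ‖f x - f (x + z)‖ₑ := by
        rw [lintegral_lintegral_swap]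
        exact m1.aemeasurable
    _ ≤ ENNReal.ofReal (volume.real B)⁻¹ * ∫⁻ z in B, ENNReal.ofReal ε := by
        gcongr 1
        refine setLIntegral_mono measurable_const fun z hz => ?_
        have h2 : ∫⁻ x, ‖f x - f (x + z)‖ₑ = ‖f - tau z f‖ₑ := by
          rw [L1d_enorm_sub]
          refine lintegral_congr_ae ?_
          filter_upwards [tau_coe z f] with x hx
          rw [hx]
        rw [h2, ← ofReal_norm]
        refine ENNReal.ofReal_le_ofReal ?_
        rw [norm_sub_rev]
        exact h z hz
    _ = ENNReal.ofReal ε := by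
        rw [setLIntegral_const, ← ENNReal.ofReal_toReal hB, ← Measure.real,
          ← ENNReal.ofReal_mul hε, ← ENNReal.ofReal_mul (by positivity)]
        congr 1
        field_simp

/-- Kolmogorov–Riesz -/
lemma kolmogorov_riesz (F : Set (L1d d)) (C : ℝ) (hC : ∀ f ∈ F, ‖f‖ ≤ C)
    (heq : ∀ ε > 0, ∃ δ > 0, ∀ z, ‖z‖ < δ → ∀ f ∈ F, ‖tau z f - f‖ ≤ ε)
    (htight : ∀ ε > 0, ∃ R : ℝ, ∀ f ∈ F,
      ∫⁻ x in (Metric.closedBall 0 R)ᶜ, ‖f x‖ₑ ≤ ENNReal.ofReal ε) :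
    TotallyBounded F := by
  rw [Metric.totallyBounded_iff]
  intro ε₀ hε₀
  set ε := ε₀ / 6 with hε
  have hεpos : 0 < ε := by positivity
  obtain ⟨R, hR⟩ := htight ε hεpos
  obtain ⟨δ, hδ, hδ2⟩ := heq ε hεpos
  set B : Set (Fin d → ℝ) := Metric.ball 0 δ with hBdef
  have hBtop : volume B ≠ ⊤ := Metric.isBounded_ball.measure_lt_top.ne
  have hB0 : volume B ≠ 0 := (Metric.measure_ball_pos volume _ hδ).ne'
  have hV : 0 < volume.real B := ENNReal.toReal_pos hB0 hBtop
  set K : Set (Fin d → ℝ) := Metric.closedBall 0 R with hK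
  have hKc : IsCompact K := isCompact_closedBall _ _
  have : CompactSpace K := isCompact_iff_compactSpace.1 hKc
  have hequi : ∀ η > 0, ∃ δ' > 0, ∀ x x', dist x x' < δ' → ∀ f ∈ F,
      |lavg B f x - lavg B f x'| < η := by
    intro η hη
    obtain ⟨δ', h1, h2⟩ := heq (volume.real B * (η / 2)) (by positivity)
    refine ⟨δ', h1, fun x x' hx f hf => ?_⟩
    refine (lavg_sub B f x x').trans_lt ?_
    have := h2 (x - x') (by rwa [← dist_eq_norm]) f hf
    calc _ ≤ (volume.real B)⁻¹ * (volume.real B * (η / 2)) := by gcongr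
      _ = η / 2 := by field_simp
      _ < η := by linarith
  have hcont : ∀ f ∈ F, Continuous (lavg B f) := by
    intro f hf
    rw [Metric.continuous_iff]
    intro b η hη
    obtain ⟨δ', h1, h2⟩ := hequi η hη
    exact ⟨δ', h1, fun a ha => h2 a b ha f hf⟩
  let g : F → BoundedContinuousFunction K ℝ := fun f =>
    BoundedContinuousFunction.mkOfCompact ⟨fun x => lavg B f.1 x.1,
      (hcont f.1 f.2).comp continuous_subtype_val⟩
  have hA : TotallyBounded (Set.range g) := by
    refine TotallyBounded.subset subset_closure (IsCompact.totallyBounded ?_)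
    refine BoundedContinuousFunction.arzela_ascoli
      (Metric.closedBall (0:ℝ) ((volume.real B)⁻¹ * C)) (isCompact_closedBall _ _) _ ?_ ?_
    · rintro _ x ⟨f, rfl⟩
      rw [mem_closedBall_zero_iff]
      refine (lavg_bound B f.1 x.1).trans ?_
      gcongr
      exact hC _ f.2
    · intro x
      rw [Metric.equicontinuousAt_iff]
      intro η hη
      obtain ⟨δ', h1, h2⟩ := hequi η hη
      refine ⟨δ', h1, ?_⟩
      rintro x' hx' ⟨_, f, rfl⟩
      rw [dist_comm] at hx'
      exact h2 x.1 x'.1 hx' f.1 f.2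
  rw [Metric.totallyBounded_iff] at hA
  set VK := volume.real K with hVK
  have hVK0 : 0 ≤ VK := measureReal_nonneg
  have hη : 0 < ε / (2 * (VK + 1)) := by positivity
  obtain ⟨t, ht, hcov⟩ := Metric.totallyBounded_iff.1 (Metric.totallyBounded_iff.2 hA)
    _ hη
  -- pick representatives
  classical
  let s : Set (BoundedContinuousFunction K ℝ) :=
    {y ∈ t | ∃ f : F, dist (g f) y < ε / (2 * (VK + 1))}
  have hs : s.Finite := ht.subset fun y hy => hy.1
  have hex : ∀ y : s, ∃ f : F, dist (g f) y.1 < ε / (2 * (VK + 1)) := fun y => y.2.2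
  choose r hr using hex
  have := hs.to_subtype
  refine ⟨Set.range fun y : s => (r y : L1d d), Set.finite_range _, ?_⟩
  intro f hf
  have h1 := hcov ⟨⟨f, hf⟩, rfl⟩
  simp only [Set.mem_iUnion, Metric.mem_ball, exists_prop] at h1
  obtain ⟨y, hy, hfy⟩ := h1
  have hys : y ∈ s := ⟨hy, ⟨f, hf⟩, hfy⟩
  simp only [Set.mem_iUnion, Set.mem_range, exists_prop, exists_exists_eq_and]
  refine ⟨⟨y, hys⟩, ?_⟩
  set f' : L1d d := (r ⟨y, hys⟩ : L1d d) with hf'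
  have hf'F : f' ∈ F := (r ⟨y, hys⟩).2
  have hdist : ∀ x ∈ K, |lavg B f x - lavg B f' x| ≤ ε / (VK + 1) := by
    intro x hx
    have h2 : dist (g ⟨f, hf⟩) (g (r ⟨y, hys⟩)) ≤ ε / (VK + 1) := by
      have := dist_triangle_right (g ⟨f, hf⟩) (g (r ⟨y, hys⟩)) y
      have h3 := hr ⟨y, hys⟩
      have h4 : ε / (2 * (VK + 1)) + ε / (2 * (VK + 1)) = ε / (VK + 1) := by field_simp; norm_num
      simp only at h3
      linarith
    have h3 := BoundedContinuousFunction.dist_coe_le_dist (f := g ⟨f, hf⟩)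
      (g := g (r ⟨y, hys⟩)) ⟨x, hx⟩
    exact h3.trans h2
  have hsmall : ∀ f ∈ F, ∀ z ∈ B, ‖tau z f - f‖ ≤ ε := fun f hf z hz =>
    hδ2 z (by simpa [hBdef] using hz) f hf
  have ha : ∀ f ∈ F, ∫⁻ x, ‖f x - lavg B f x‖ₑ ≤ ENNReal.ofReal ε := fun f hf =>
    lavg_approx measurableSet_ball hBtop hB0 f hεpos.le (hsmall f hf)
  have hfm := L1d_meas f
  have hfm' := L1d_meas f'
  have hlm := (hcont f hf).measurable
  have hlm' := (hcont f' hf'F).measurable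
  have key : ‖f - f'‖ₑ ≤ ENNReal.ofReal (5 * ε) := by
    rw [L1d_enorm_sub, ← lintegral_add_compl _ (measurableSet_closedBall (x := (0 : Fin d → ℝ)) (ε := R))]
    have p1 : ∫⁻ x in K, ‖f x - f' x‖ₑ ≤ ENNReal.ofReal (3 * ε) := by
      calc ∫⁻ x in K, ‖f x - f' x‖ₑ
          ≤ ∫⁻ x in K, (‖f x - lavg B f x‖ₑ + ENNReal.ofReal (ε / (VK + 1)) +
              ‖f' x - lavg B f' x‖ₑ) := by
            refine setLIntegral_mono ((hfm.sub hlm).enorm.add_const _ |>.add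
              (hfm'.sub hlm').enorm) fun x hx => ?_
            have e : f x - f' x = (f x - lavg B f x) + (lavg B f x - lavg B f' x)
              - (f' x - lavg B f' x) := by ring
            rw [e]
            refine (enorm_sub_le).trans ?_
            gcongr
            refine (enorm_add_le _ _).trans ?_
            gcongr
            rw [Real.enorm_eq_ofReal_abs]
            exact ENNReal.ofReal_le_ofReal (hdist x hx)
        _ = (∫⁻ x in K, ‖f x - lavg B f x‖ₑ) + (∫⁻ x in K, ENNReal.ofReal (ε / (VK + 1))) +
              (∫⁻ x in K, ‖f' x - lavg B f' x‖ₑ) := by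
            have q' : Measurable fun x => ‖f' x - lavg B f' x‖ₑ := (hfm'.sub hlm').enorm
            rw [lintegral_add_right _ q',
              lintegral_add_right _ measurable_const]
        _ ≤ ENNReal.ofReal ε + ENNReal.ofReal ε + ENNReal.ofReal ε := by
            gcongr
            · exact (setLIntegral_le_lintegral _ _).trans (ha f hf)
            · rw [setLIntegral_const, ← ENNReal.ofReal_toReal hKc.measure_lt_top.ne,
                ← ENNReal.ofReal_mul (by positivity)]
              refine ENNReal.ofReal_le_ofReal ?_
              change ε / (VK + 1) * VK ≤ ε
              rw [div_mul_eq_mul_div, div_le_iff₀ (by positivity)]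
              nlinarith
            · exact (setLIntegral_le_lintegral _ _).trans (ha f' hf'F)
        _ = _ := by
            rw [← ENNReal.ofReal_add hεpos.le hεpos.le,
              ← ENNReal.ofReal_add (by positivity) hεpos.le]
            congr 1; ring
    have p2 : ∫⁻ x in Kᶜ, ‖f x - f' x‖ₑ ≤ ENNReal.ofReal (2 * ε) := by
      calc ∫⁻ x in Kᶜ, ‖f x - f' x‖ₑ ≤ ∫⁻ x in Kᶜ, (‖f x‖ₑ + ‖f' x‖ₑ) :=
            lintegral_mono fun x => enorm_sub_le
        _ = (∫⁻ x in Kᶜ, ‖f x‖ₑ) + ∫⁻ x in Kᶜ, ‖f' x‖ₑ := lintegral_add_right _ hfm'.enorm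
        _ ≤ ENNReal.ofReal ε + ENNReal.ofReal ε := add_le_add (hR f hf) (hR f' hf'F)
        _ = _ := by
            rw [← ENNReal.ofReal_add hεpos.le hεpos.le]
            congr 1; ring
    refine (add_le_add p1 p2).trans (le_of_eq ?_)
    rw [← ENNReal.ofReal_add (by positivity) (by positivity)]
    congr 1; ring
  rw [← ofReal_norm, ENNReal.ofReal_le_ofReal_iff (by positivity)] at key
  rw [Metric.mem_ball, dist_eq_norm]
  linarith

end KR

section Nem
variable {d : ℕ}

lemma L1d_subseq_ae {u : ℕ → L1d d} {v : L1d d} (h : Tendsto u atTop (nhds v)) :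
    ∃ ns : ℕ → ℕ, StrictMono ns ∧ ∀ᵐ x, Tendsto (fun k => u (ns k) x) atTop (nhds (v x)) :=
  (tendstoInMeasure_of_tendsto_Lp h).exists_seq_tendsto_ae

lemma Bd_closed (M : ℝ) : IsClosed {u : L1d d | Bd M u} := by
  refine IsSeqClosed.isClosed ?_
  intro u v hu hv
  obtain ⟨ns, _, hns⟩ := L1d_subseq_ae hv
  have h1 : ∀ᵐ x, ∀ k, |u (ns k) x| ≤ M := ae_all_iff.2 fun k => hu (ns k)
  change ∀ᵐ x, |v x| ≤ M
  filter_upwards [hns, h1] with x hx hb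
  exact le_of_tendsto hx.abs (Eventually.of_forall hb)

lemma Bd_dense (u : L1d d) {ε : ℝ} (hε : 0 < ε) : ∃ v : L1d d, ∃ M : ℝ, 0 ≤ M ∧ Bd M v ∧
    ‖u - v‖ ≤ ε := by
  obtain ⟨g, hg, hgi⟩ := (L1d_int u).exists_boundedContinuous_integral_sub_le hε
  refine ⟨hgi.toL1 g, ‖g‖, norm_nonneg _, ?_, ?_⟩
  · change ∀ᵐ x, |hgi.toL1 g x| ≤ ‖g‖
    filter_upwards [hgi.coeFn_toL1] with x hx
    rw [hx]
    exact g.norm_coe_le_norm x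
  · rw [L1d_norm_sub]
    refine le_trans (le_of_eq ?_) hg
    refine integral_congr_ae ?_
    filter_upwards [hgi.coeFn_toL1] with x hx
    rw [hx]; rfl

lemma Nem_int {c : ℝ → ℝ} (hc : Continuous c) {C : ℝ} (hC : ∀ r, |c r| ≤ C) (u : L1d d) :
    Integrable fun x => c (u x) * u x :=
  (L1d_int u).bdd_mul (c := C) (hc.measurable.comp (L1d_meas u)).aestronglyMeasurable
    (ae_of_all _ fun x => hC _)

lemma Nem_tendsto_seq {c : ℝ → ℝ} (hc : Continuous c) {C : ℝ} (hC : ∀ r, |c r| ≤ C)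
    {u : ℕ → L1d d} {v : L1d d} (h : Tendsto u atTop (nhds v)) :
    Tendsto (fun n => ∫ x, |c (u n x) * u n x - c (v x) * v x|) atTop (nhds 0) := by
  refine tendsto_of_subseq_tendsto fun ns hns => ?_
  obtain ⟨ms, _, hms⟩ := L1d_subseq_ae (h.comp hns)
  have hms' : Tendsto ms atTop atTop := by apply StrictMono.tendsto_atTop; assumption
  refine ⟨ms, ?_⟩
  have hn : Tendsto (fun n => ‖u (ns (ms n)) - v‖) atTop (nhds 0) :=
    (tendsto_iff_norm_sub_tendsto_zero.1 h).comp (hns.comp hms')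
  have hd : Tendsto (fun n => ∫ x, |c (u (ns (ms n)) x) - c (v x)| * |v x|) atTop (nhds 0) := by
    have : Tendsto (fun n => ∫ x, |c (u (ns (ms n)) x) - c (v x)| * |v x|) atTop
        (nhds (∫ _x : Fin d → ℝ, (0:ℝ))) := by
      refine tendsto_integral_of_dominated_convergence (fun x => (2 * C) * |v x|) ?_
        ((L1d_int v).abs.const_mul _) ?_ ?_
      · intro n
        exact ((((hc.measurable.comp (L1d_meas _)).sub (hc.measurable.comp (L1d_meas v))).abs).mul
          (L1d_meas v).abs).aestronglyMeasurable
      · intro n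
        refine ae_of_all _ fun x => ?_
        rw [Real.norm_eq_abs, abs_mul, abs_abs, abs_abs]
        gcongr
        refine (abs_sub _ _).trans ?_
        have := hC (u (ns (ms n)) x)
        have := hC (v x)
        linarith
      · filter_upwards [hms] with x hx
        have h1 : Tendsto (fun n => |c (u (ns (ms n)) x) - c (v x)| * |v x|) atTop
            (nhds (|c (v x) - c (v x)| * |v x|)) :=
          ((((hc.tendsto _).comp hx).sub_const _).abs).mul_const _
        simpa using h1
    simpa using this
  have hs := (hn.const_mul C).add hd
  simp only [mul_zero, add_zero] at hs
  refine squeeze_zero (fun n => integral_nonneg fun x => abs_nonneg _) (fun n => ?_) hs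
  rw [L1d_norm_sub, ← integral_const_mul, ← integral_add]
  · refine integral_mono_of_nonneg (ae_of_all _ fun x => abs_nonneg _) ?_ (ae_of_all _ fun x => ?_)
    · refine (((L1d_int _).sub (L1d_int v)).abs.const_mul C).add ?_
      refine ((L1d_int v).abs).bdd_mul (c := 2 * C) ((hc.measurable.comp (L1d_meas _)).sub
        (hc.measurable.comp (L1d_meas v))).abs.aestronglyMeasurable (ae_of_all _ fun x => ?_)
      rw [Real.norm_eq_abs, abs_abs]
      refine (abs_sub _ _).trans ?_
      have := hC (u (ns (ms n)) x)
      have := hC (v x)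
      linarith
    · set a := u (ns (ms n)) x
      set b := v x
      have e : c a * a - c b * b = c a * (a - b) + (c a - c b) * b := by ring
      change |c a * a - c b * b| ≤ C * |a - b| + |c a - c b| * |b|
      rw [e]
      refine (abs_add_le _ _).trans ?_
      rw [abs_mul, abs_mul]
      gcongr
      exact hC _
  · exact ((L1d_int _).sub (L1d_int v)).abs.const_mul C
  · refine ((L1d_int v).abs).bdd_mul (c := 2 * C) ((hc.measurable.comp (L1d_meas _)).sub
        (hc.measurable.comp (L1d_meas v))).abs.aestronglyMeasurable (ae_of_all _ fun x => ?_)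
    rw [Real.norm_eq_abs, abs_abs]
    refine (abs_sub _ _).trans ?_
    have := hC (u (ns (ms n)) x)
    have := hC (v x)
    linarith

/-- Nemytskii operator `u ↦ c(u) u` on `L¹`. -/
noncomputable def Nem (c : ℝ → ℝ) (hc : Continuous c) (C : ℝ) (hC : ∀ r, |c r| ≤ C)
    (u : L1d d) : L1d d := (Nem_int hc hC u).toL1 _

lemma Nem_coe {c : ℝ → ℝ} (hc : Continuous c) {C : ℝ} (hC : ∀ r, |c r| ≤ C) (u : L1d d) :
    Nem c hc C hC u =ᵐ[volume] fun x => c (u x) * u x := Integrable.coeFn_toL1 _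

lemma Nem_cont {c : ℝ → ℝ} (hc : Continuous c) {C : ℝ} (hC : ∀ r, |c r| ≤ C) :
    Continuous (Nem (d := d) c hc C hC) := by
  rw [continuous_iff_seqContinuous]
  intro u v h
  rw [tendsto_iff_norm_sub_tendsto_zero]
  refine (Nem_tendsto_seq hc hC h).congr fun n => ?_
  simp only [Function.comp]
  rw [L1d_norm_sub]
  refine integral_congr_ae ?_
  filter_upwards [Nem_coe hc hC (u n), Nem_coe hc hC v] with x h1 h2
  rw [h1, h2]

lemma Nem_norm {c : ℝ → ℝ} (hc : Continuous c) {C : ℝ} (hC : ∀ r, |c r| ≤ C) (u : L1d d) :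
    ‖Nem c hc C hC u‖ ≤ C * ‖u‖ := by
  rw [L1d_norm, L1d_norm, ← integral_const_mul]
  refine integral_mono_ae (L1d_int _).abs ((L1d_int u).abs.const_mul C) ?_
  filter_upwards [Nem_coe hc hC u] with x h1
  rw [h1, abs_mul]
  have := hC (u x)
  gcongr

/-- pairing with a bounded test function -/
lemma pair_le {f ψ : (Fin d → ℝ) → ℝ} (hf : Integrable f) {C : ℝ} (hψ : ∀ x, |ψ x| ≤ C) :
    |∫ x, f x * ψ x| ≤ C * ∫ x, |f x| := by
  rw [← integral_const_mul, ← Real.norm_eq_abs]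
  refine norm_integral_le_of_norm_le (hf.abs.const_mul C) (ae_of_all _ fun x => ?_)
  rw [Real.norm_eq_abs, abs_mul, mul_comm]
  gcongr
  exact hψ x

lemma L1d_pair_le (u : L1d d) {ψ : (Fin d → ℝ) → ℝ} {C : ℝ} (hψ : ∀ x, |ψ x| ≤ C) :
    |∫ x, u x * ψ x| ≤ C * ‖u‖ := by
  rw [L1d_norm]; exact pair_le (L1d_int u) hψ

lemma L1d_pair_int (u : L1d d) {ψ : (Fin d → ℝ) → ℝ} (hψ : Continuous ψ) {C : ℝ}
    (hC : ∀ x, |ψ x| ≤ C) : Integrable fun x => u x * ψ x :=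
  (L1d_int u).mul_bdd (c := C) hψ.aestronglyMeasurable (ae_of_all _ hC)

lemma L1d_pair_sub (u v : L1d d) {ψ : (Fin d → ℝ) → ℝ} (hψ : Continuous ψ) {C : ℝ}
    (hC : ∀ x, |ψ x| ≤ C) :
    ∫ x, (u - v : L1d d) x * ψ x = (∫ x, u x * ψ x) - ∫ x, v x * ψ x := by
  rw [← integral_sub (L1d_pair_int u hψ hC) (L1d_pair_int v hψ hC)]
  refine integral_congr_ae ?_
  filter_upwards [Lp.coeFn_sub u v] with x hx
  rw [hx, Pi.sub_apply, sub_mul]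

lemma L1d_pair_cont {ψ : (Fin d → ℝ) → ℝ} (hψ : Continuous ψ) {C : ℝ}
    (hC : ∀ x, |ψ x| ≤ C) : Continuous fun u : L1d d => ∫ x, u x * ψ x := by
  have hC0 : 0 ≤ C := (abs_nonneg _).trans (hC 0)
  refine LipschitzWith.continuous (K := ⟨C, hC0⟩) (LipschitzWith.of_dist_le_mul fun u v => ?_)
  rw [Real.dist_eq, ← L1d_pair_sub u v hψ hC, dist_eq_norm]
  exact L1d_pair_le _ hC

end Nem

section scheme
variable {d : ℕ}

lemma bdd_of_cs {E : Type*} [TopologicalSpace E] {f : E → ℝ} (hf : Continuous f)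
    (hc : HasCompactSupport f) : ∃ C, 0 ≤ C ∧ ∀ x, |f x| ≤ C := by
  obtain ⟨C, hC⟩ := hf.bounded_above_of_compact_support hc
  exact ⟨max C 0, le_max_right _ _, fun x => (hC x).trans (le_max_left _ _)⟩

lemma pd_cs {ψ : (Fin d → ℝ) → ℝ} (hc : HasCompactSupport ψ) (i : Fin d) :
    HasCompactSupport (pd i ψ) := hc.fderiv_apply (𝕜 := ℝ) _

lemma pd_contDiff {ψ : (Fin d → ℝ) → ℝ} {n m : WithTop ℕ∞} (h : ContDiff ℝ n ψ) (hm : m + 1 ≤ n)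
    (i : Fin d) : ContDiff ℝ m (pd i ψ) :=
  (h.fderiv_right hm).clm_apply contDiff_const

lemma pd_bdd {ψ : (Fin d → ℝ) → ℝ} (h : ContDiff ℝ 1 ψ) (hc : HasCompactSupport ψ) :
    ∃ C, 0 ≤ C ∧ ∀ i x, |pd i ψ x| ≤ C := by
  have : ∀ i, ∃ C, 0 ≤ C ∧ ∀ x, |pd i ψ x| ≤ C := fun i =>
    bdd_of_cs (pd_contDiff (m := 0) h (by norm_num) i).continuous (pd_cs hc i)
  choose C h0 hC using this
  refine ⟨∑ i, C i, Finset.sum_nonneg fun i _ => h0 i, fun i x => (hC i x).trans ?_⟩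
  exact Finset.single_le_sum (f := C) (fun i _ => h0 i) (Finset.mem_univ i)

lemma pd2_cont {ψ : (Fin d → ℝ) → ℝ} (h : ContDiff ℝ 2 ψ) (i j : Fin d) :
    Continuous (pd2 i j ψ) :=
  (pd_contDiff (m := 0) (n := 1) (pd_contDiff (m := 1) h (by norm_num) j) (by norm_num) i).continuous

lemma pd2_bdd {ψ : (Fin d → ℝ) → ℝ} (h : ContDiff ℝ 2 ψ) (hc : HasCompactSupport ψ) :
    ∃ C, 0 ≤ C ∧ ∀ i j x, |pd2 i j ψ x| ≤ C := by
  have : ∀ j, ∃ C, 0 ≤ C ∧ ∀ i x, |pd2 i j ψ x| ≤ C := fun j =>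
    pd_bdd (pd_contDiff (m := 1) h (by norm_num) j) (pd_cs hc j)
  choose C h0 hC using this
  refine ⟨∑ i, C i, Finset.sum_nonneg fun i _ => h0 i, fun i j x => (hC j i x).trans ?_⟩
  exact Finset.single_le_sum (f := C) (fun i _ => h0 i) (Finset.mem_univ j)

/-- the displacement -/
noncomputable def Ysch (β : Fin d → ℝ → ℝ) (A : ℝ → Fin d → Fin d → ℝ) (h : ℝ)
    (m : Fin d × Bool) (ξ : ℝ) : Fin d → ℝ := fun i =>
  h * β i ξ + (if m.2 then 1 else -1) * (Real.sqrt (2 * h * d) * cholS (A ξ) m.1 i)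

lemma Ysch_meas {β : Fin d → ℝ → ℝ} {A : ℝ → Fin d → Fin d → ℝ} (hβ : ∀ i, Continuous (β i))
    (hA : ∀ i j, Continuous fun ξ => A ξ i j) (h : ℝ) (m : Fin d × Bool) :
    Measurable (Ysch β A h m) := by
  rw [measurable_pi_iff]
  intro i
  have h1 : Measurable fun ξ => cholS (A ξ) m.1 i :=
    (measurable_pi_iff.1 (cholS_measurable (fun i j => (hA i j).measurable) m.1)) i
  exact ((hβ i).measurable.const_mul h).add ((h1.const_mul _).const_mul _)

variable {β : Fin d → ℝ → ℝ} {A : ℝ → Fin d → Fin d → ℝ}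

lemma Ysch_lin (hd : 1 ≤ d) (h ξ : ℝ) (p : Fin d → ℝ) :
    (Fintype.card (Fin d × Bool) : ℝ)⁻¹ * ∑ m, ∑ i, Ysch β A h m ξ i * p i
      = h * ∑ i, β i ξ * p i := by
  have hd' : (0:ℝ) < d := by exact_mod_cast hd
  have e : ∀ k, (∑ s : Bool, ∑ i, Ysch β A h (k, s) ξ i * p i) = 2 * (h * ∑ i, β i ξ * p i) := by
    intro k
    simp only [Fintype.sum_bool, Ysch, ← Finset.sum_add_distrib, Finset.mul_sum]
    refine Finset.sum_congr rfl fun i _ => ?_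
    simp; ring
  rw [Fintype.sum_prod_type, Finset.sum_congr rfl fun k _ => e k]
  simp
  field_simp

lemma Ysch_quad (hd : 1 ≤ d) (hP : ∀ ξ, IsPSD (A ξ)) {h : ℝ} (hh : 0 ≤ h) (ξ : ℝ)
    (q : Fin d → Fin d → ℝ) :
    (Fintype.card (Fin d × Bool) : ℝ)⁻¹ *
        ∑ m, ∑ i, ∑ j, Ysch β A h m ξ i * Ysch β A h m ξ j * q i j
      = h ^ 2 * (∑ i, ∑ j, β i ξ * β j ξ * q i j) + 2 * h * ∑ i, ∑ j, A ξ i j * q i j := by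
  have hd' : (0:ℝ) < d := by exact_mod_cast hd
  have hs : Real.sqrt (2 * h * d) ^ 2 = 2 * h * d := Real.sq_sqrt (by positivity)
  have e : ∀ k, (∑ s : Bool, ∑ i, ∑ j, Ysch β A h (k, s) ξ i * Ysch β A h (k, s) ξ j * q i j)
      = 2 * (h ^ 2 * (∑ i, ∑ j, β i ξ * β j ξ * q i j)) +
        (4 * h * d) * ∑ i, ∑ j, (cholS (A ξ) k i * cholS (A ξ) k j) * q i j := by
    intro k
    simp only [Fintype.sum_bool, Ysch, ← Finset.sum_add_distrib, Finset.mul_sum]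
    refine Finset.sum_congr rfl fun i _ => Finset.sum_congr rfl fun j _ => ?_
    simp only [if_true, Bool.false_eq_true, if_false]
    linear_combination (2 * cholS (A ξ) k i * cholS (A ξ) k j * q i j) * hs
  have e2 : ∑ k, ∑ i, ∑ j, (cholS (A ξ) k i * cholS (A ξ) k j) * q i j
      = ∑ i, ∑ j, A ξ i j * q i j := by
    rw [Finset.sum_comm]
    refine Finset.sum_congr rfl fun i _ => ?_
    rw [Finset.sum_comm]
    refine Finset.sum_congr rfl fun j _ => ?_
    rw [← Finset.sum_mul, ← chol_sum (hP ξ)]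
  rw [Fintype.sum_prod_type, Finset.sum_congr rfl fun k _ => e k, Finset.sum_add_distrib,
    ← Finset.mul_sum Finset.univ (fun k => ∑ i, ∑ j, cholS (A ξ) k i * cholS (A ξ) k j * q i j), e2]
  simp
  field_simp
  ring

lemma cont_bdd_Icc {f : ℝ → ℝ} (hf : Continuous f) (M : ℝ) :
    ∃ C, 0 ≤ C ∧ ∀ ξ, |ξ| ≤ M → |f ξ| ≤ C := by
  obtain ⟨C, hC⟩ := (isCompact_Icc (a := -M) (b := M)).exists_bound_of_continuousOn hf.continuousOn
  exact ⟨max C 0, le_max_right _ _, fun x hx => (hC x (abs_le.1 hx)).trans (le_max_left _ _)⟩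

lemma coef_bdd (hβ : ∀ i, Continuous (β i))
    (hA : ∀ i j, Continuous fun ξ => A ξ i j) (M : ℝ) :
    ∃ K, 0 ≤ K ∧ ∀ ξ, |ξ| ≤ M → (∀ i, |β i ξ| ≤ K) ∧ (∀ i j, |A ξ i j| ≤ K) := by
  choose C1 h1 h1' using fun i => cont_bdd_Icc (hβ i) M
  choose C2 h2 h2' using fun i j => cont_bdd_Icc (hA i j) M
  refine ⟨(∑ i, C1 i) + ∑ i, ∑ j, C2 i j, ?_, fun ξ hξ => ⟨fun i => ?_, fun i j => ?_⟩⟩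
  · exact add_nonneg (Finset.sum_nonneg fun i _ => h1 i)
      (Finset.sum_nonneg fun i _ => Finset.sum_nonneg fun j _ => h2 i j)
  · have a1 := Finset.single_le_sum (f := C1) (fun i _ => h1 i) (Finset.mem_univ i)
    have a2 : 0 ≤ ∑ i, ∑ j, C2 i j :=
      Finset.sum_nonneg fun i _ => Finset.sum_nonneg fun j _ => h2 i j
    linarith [h1' i ξ hξ]
  · have a1 := Finset.single_le_sum (f := C2 i) (fun j _ => h2 i j) (Finset.mem_univ j)
    have a2 := Finset.single_le_sum (f := fun i => ∑ j, C2 i j)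
      (fun i _ => Finset.sum_nonneg fun j _ => h2 i j) (Finset.mem_univ i)
    have a3 : 0 ≤ ∑ i, C1 i := Finset.sum_nonneg fun i _ => h1 i
    linarith [h2' i j ξ hξ]

lemma Ysch_norm (hβ : ∀ i, Continuous (β i))
    (hA : ∀ i j, Continuous fun ξ => A ξ i j) (hP : ∀ ξ, IsPSD (A ξ)) (M : ℝ) :
    ∃ K, 0 ≤ K ∧ ∀ ξ, |ξ| ≤ M → ∀ h, 0 < h → h ≤ 1 → ∀ m,
      ‖Ysch β A h m ξ‖ ≤ K * Real.sqrt h := by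
  obtain ⟨K, hK, hb⟩ := coef_bdd hβ hA M
  refine ⟨K + Real.sqrt (2 * d) * Real.sqrt K, by positivity, fun ξ hξ h h0 h1 m => ?_⟩
  rw [pi_norm_le_iff_of_nonneg (by positivity)]
  intro i
  have hsq : h ≤ Real.sqrt h := by
    rw [Real.le_sqrt h0.le h0.le]; nlinarith
  have e1 : Real.sqrt (2 * h * d) = Real.sqrt (2 * d) * Real.sqrt h := by
    rw [← Real.sqrt_mul (by positivity)]; ring_nf
  have e2 : |cholS (A ξ) m.1 i| ≤ Real.sqrt K := by
    apply Real.abs_le_sqrt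
    exact (chol_bound (hP ξ) i m.1).trans ((le_abs_self _).trans ((hb ξ hξ).2 i i))
  have e3 := (hb ξ hξ).1 i
  have e4 : |(if m.2 then (1:ℝ) else -1)| = 1 := by split_ifs <;> simp
  rw [Real.norm_eq_abs, Ysch]
  refine (abs_add_le _ _).trans ?_
  rw [abs_mul, abs_mul, e4, abs_mul, abs_of_pos h0, e1, one_mul, abs_of_nonneg (by positivity :
    0 ≤ Real.sqrt (2 * d) * Real.sqrt h)]
  calc h * |β i ξ| + Real.sqrt (2 * d) * Real.sqrt h * |cholS (A ξ) m.1 i|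
      ≤ Real.sqrt h * K + Real.sqrt (2 * d) * Real.sqrt h * Real.sqrt K := by gcongr
    _ = _ := by ring

lemma lin_bdd {K C : ℝ} (hK : 0 ≤ K) {f g : Fin d → ℝ} (hf : ∀ i, |f i| ≤ K)
    (hg : ∀ i, |g i| ≤ C) : |∑ i, f i * g i| ≤ d * (K * C) := by
  refine (Finset.abs_sum_le_sum_abs _ _).trans ?_
  calc ∑ i, |f i * g i| ≤ ∑ _i : Fin d, K * C := by
        refine Finset.sum_le_sum fun i _ => ?_
        rw [abs_mul]
        exact mul_le_mul (hf i) (hg i) (abs_nonneg _) hK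
    _ = _ := by simp

lemma quad_bdd {K C : ℝ} (hK : 0 ≤ K) {f g : Fin d → Fin d → ℝ} (hf : ∀ i j, |f i j| ≤ K)
    (hg : ∀ i j, |g i j| ≤ C) : |∑ i, ∑ j, f i j * g i j| ≤ d * (d * (K * C)) := by
  refine (Finset.abs_sum_le_sum_abs _ _).trans ?_
  calc ∑ i, |∑ j, f i j * g i j| ≤ ∑ _i : Fin d, d * (K * C) :=
        Finset.sum_le_sum fun i _ => lin_bdd hK (hf i) (hg i)
    _ = _ := by simp

/-- crude consistency, with scaling -/
lemma cons_crude (hd : 1 ≤ d) (hβ : ∀ i, Continuous (β i))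
    (hA : ∀ i j, Continuous fun ξ => A ξ i j) (hP : ∀ ξ, IsPSD (A ξ)) (M : ℝ)
    {η : (Fin d → ℝ) → ℝ} (hη : ContDiff ℝ 2 η) (hc : HasCompactSupport η) :
    ∃ C, 0 ≤ C ∧ ∀ r h : ℝ, 0 ≤ r → r ≤ 1 → 0 < h → h ≤ 1 → ∀ p : ℝ × (Fin d → ℝ), |p.1| ≤ M →
      |Eavg (Ysch β A h) (fun x => η (r • x)) p - η (r • p.2)| ≤ C * h * r := by
  obtain ⟨K, hK, hKb⟩ := coef_bdd hβ hA M
  obtain ⟨K', hK', hY⟩ := Ysch_norm hβ hA hP M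
  obtain ⟨C1, hC1, ht⟩ := taylor_one η hη hc
  obtain ⟨C2, hC2, hp⟩ := pd_bdd (hη.of_le (by norm_num)) hc
  have hne : Nonempty (Fin d × Bool) := ⟨(⟨0, hd⟩, true)⟩
  refine ⟨C1 * K' ^ 2 + d * (K * C2), by positivity, fun r h hr hr1 h0 h1 p hpM => ?_⟩
  have e : Eavg (Ysch β A h) (fun x => η (r • x)) p - η (r • p.2) =
      (Fintype.card (Fin d × Bool) : ℝ)⁻¹ * ∑ m, (η (r • p.2 + r • Ysch β A h m p.1) - η (r • p.2)
        - fderiv ℝ η (r • p.2) (r • Ysch β A h m p.1)) +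
      r * (h * ∑ i, β i p.1 * pd i η (r • p.2)) := by
    rw [← Ysch_lin (A := A) hd, Eavg]
    simp only [Finset.sum_sub_distrib, smul_add, map_smul, fderiv_eq_sum_pd, mul_sub,
      smul_eq_mul]
    rw [avg_const, ← Finset.mul_sum]
    ring
  rw [e]
  refine (abs_add_le _ _).trans ?_
  have b1 : |(Fintype.card (Fin d × Bool) : ℝ)⁻¹ * ∑ m, (η (r • p.2 + r • Ysch β A h m p.1)
      - η (r • p.2) - fderiv ℝ η (r • p.2) (r • Ysch β A h m p.1))| ≤ C1 * K' ^ 2 * h * r := by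
    refine avg_abs_le fun m => (ht _ _).trans ?_
    have := hY p.1 hpM h h0 h1 m
    have h2 : ‖r • Ysch β A h m p.1‖ ≤ r * (K' * Real.sqrt h) := by
      rw [norm_smul, Real.norm_eq_abs, abs_of_nonneg hr]; gcongr
    calc C1 * ‖r • Ysch β A h m p.1‖ ^ 2 ≤ C1 * (r * (K' * Real.sqrt h)) ^ 2 := by gcongr
      _ = C1 * K' ^ 2 * h * (r * r) := by
          rw [mul_pow, mul_pow, Real.sq_sqrt h0.le]; ring
      _ ≤ C1 * K' ^ 2 * h * (r * 1) := by gcongr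
      _ = _ := by ring
  have b2 : |r * (h * ∑ i, β i p.1 * pd i η (r • p.2))| ≤ r * (h * (d * (K * C2))) := by
    rw [abs_mul, abs_mul, abs_of_nonneg hr, abs_of_pos h0]
    gcongr
    exact lin_bdd hK (hKb p.1 hpM).1 (fun i => hp i _)
  calc _ ≤ C1 * K' ^ 2 * h * r + r * (h * (d * (K * C2))) := add_le_add b1 b2
    _ = _ := by ring

/-- generator on test functions -/
noncomputable def Lgen (β : Fin d → ℝ → ℝ) (A : ℝ → Fin d → Fin d → ℝ) (ψ : (Fin d → ℝ) → ℝ)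
    (p : ℝ × (Fin d → ℝ)) : ℝ :=
  (∑ i, β i p.1 * pd i ψ p.2) + ∑ i, ∑ j, A p.1 i j * pd2 i j ψ p.2

lemma cons_fine (hd : 1 ≤ d) (hβ : ∀ i, Continuous (β i))
    (hA : ∀ i j, Continuous fun ξ => A ξ i j) (hP : ∀ ξ, IsPSD (A ξ)) (M : ℝ)
    {ψ : (Fin d → ℝ) → ℝ} (hψ : ContDiff ℝ 3 ψ) (hc : HasCompactSupport ψ) :
    ∃ C, 0 ≤ C ∧ ∀ h : ℝ, 0 < h → h ≤ 1 → ∀ p : ℝ × (Fin d → ℝ), |p.1| ≤ M →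
      |Eavg (Ysch β A h) ψ p - ψ p.2 - h * Lgen β A ψ p| ≤ C * (h * Real.sqrt h) := by
  obtain ⟨K, hK, hKb⟩ := coef_bdd hβ hA M
  obtain ⟨K', hK', hY⟩ := Ysch_norm hβ hA hP M
  obtain ⟨C1, hC1, ht⟩ := taylor_two ψ hψ hc
  have hψ2 : ContDiff ℝ 2 ψ := hψ.of_le (by norm_num)
  obtain ⟨C2, hC2, hp⟩ := pd2_bdd hψ2 hc
  have hne : Nonempty (Fin d × Bool) := ⟨(⟨0, hd⟩, true)⟩
  refine ⟨C1 * K' ^ 3 + d * (d * (K * K * C2)), by positivity, fun h h0 h1 p hpM => ?_⟩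
  have e : Eavg (Ysch β A h) ψ p - ψ p.2 - h * Lgen β A ψ p =
      (Fintype.card (Fin d × Bool) : ℝ)⁻¹ * ∑ m, (ψ (p.2 + Ysch β A h m p.1) - ψ p.2
        - fderiv ℝ ψ p.2 (Ysch β A h m p.1)
        - (1 / 2 : ℝ) • fderiv ℝ (fderiv ℝ ψ) p.2 (Ysch β A h m p.1) (Ysch β A h m p.1)) +
      1 / 2 * (h ^ 2 * (∑ i, ∑ j, β i p.1 * β j p.1 * pd2 i j ψ p.2)) := by
    have q := Ysch_quad (β := β) hd hP h0.le p.1 (fun i j => pd2 i j ψ p.2)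
    have l := Ysch_lin (β := β) (A := A) hd h p.1 (fun i => pd i ψ p.2)
    simp only [Finset.sum_sub_distrib, fderiv_eq_sum_pd, fderiv2_eq_sum_pd2 ψ hψ2,
      ← Finset.mul_sum, mul_sub, smul_eq_mul]
    rw [l, avg_const, Eavg, Lgen]
    rw [mul_left_comm _ (1 / 2 : ℝ), q]
    ring
  rw [e]
  refine (abs_add_le _ _).trans ?_
  have b1 : |(Fintype.card (Fin d × Bool) : ℝ)⁻¹ * ∑ m, (ψ (p.2 + Ysch β A h m p.1) - ψ p.2
        - fderiv ℝ ψ p.2 (Ysch β A h m p.1)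
        - (1 / 2 : ℝ) • fderiv ℝ (fderiv ℝ ψ) p.2 (Ysch β A h m p.1) (Ysch β A h m p.1))|
      ≤ C1 * K' ^ 3 * (h * Real.sqrt h) := by
    refine avg_abs_le fun m => (ht _ _).trans ?_
    have := hY p.1 hpM h h0 h1 m
    calc C1 * ‖Ysch β A h m p.1‖ ^ 3 ≤ C1 * (K' * Real.sqrt h) ^ 3 := by gcongr
      _ = C1 * K' ^ 3 * (Real.sqrt h ^ 2 * Real.sqrt h) := by ring
      _ = _ := by rw [Real.sq_sqrt h0.le]
  have hsq : h ≤ Real.sqrt h := by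
    rw [Real.le_sqrt h0.le h0.le]; nlinarith
  have b2 : |1 / 2 * (h ^ 2 * (∑ i, ∑ j, β i p.1 * β j p.1 * pd2 i j ψ p.2))|
      ≤ (d * (d * (K * K * C2))) * (h * Real.sqrt h) := by
    rw [abs_mul, abs_mul, abs_of_nonneg (by positivity : 0 ≤ h ^ 2)]
    have hb := (hKb p.1 hpM).1
    have := quad_bdd (mul_nonneg hK hK) (f := fun i j => β i p.1 * β j p.1)
      (g := fun i j => pd2 i j ψ p.2)
      (fun i j => by rw [abs_mul]; exact mul_le_mul (hb i) (hb j) (abs_nonneg _) hK)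
      (fun i j => hp i j _)
    calc |(1 / 2 : ℝ)| * (h ^ 2 * |∑ i, ∑ j, β i p.1 * β j p.1 * pd2 i j ψ p.2|)
        ≤ 1 * (h ^ 2 * (d * (d * (K * K * C2)))) := by
          gcongr
          rw [abs_of_pos (by norm_num)]; norm_num
      _ = (d * (d * (K * K * C2))) * (h * h) := by ring
      _ ≤ _ := by gcongr
  calc _ ≤ _ := add_le_add b1 b2
    _ = _ := by ring

end scheme

/-- data of the kinetic scheme -/
structure FPData (d : ℕ) where
  β : Fin d → ℝ → ℝ
  A : ℝ → Fin d → Fin d → ℝ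
  hd : 1 ≤ d
  hβ : ∀ i, Continuous (β i)
  hA : ∀ i j, Continuous fun ξ => A ξ i j
  hP : ∀ ξ, IsPSD (A ξ)

section scheme2
variable {d : ℕ} (D : FPData d)

/-- one step of the scheme -/
noncomputable def FPData.T (h : ℝ) (u : L1d d) : L1d d :=
  Tavg (Ysch D.β D.A h) (Ysch_meas D.hβ D.hA h) u

lemma FPData.ne {d : ℕ} (D : FPData d) : Nonempty (Fin d × Bool) := ⟨(⟨0, D.hd⟩, true)⟩

lemma T_contr (h : ℝ) (u v : L1d d) : ‖D.T h u - D.T h v‖ ≤ ‖u - v‖ := by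
  have := D.ne
  exact Tavg_contr _ _ u v

lemma it_contr (h : ℝ) (k : ℕ) (u v : L1d d) :
    ‖(D.T h)^[k] u - (D.T h)^[k] v‖ ≤ ‖u - v‖ := by
  induction k with
  | zero => simp
  | succ k ih =>
    rw [Function.iterate_succ_apply', Function.iterate_succ_apply']
    exact (T_contr D h _ _).trans ih

lemma it_zero (h : ℝ) (k : ℕ) : (D.T h)^[k] 0 = 0 := by
  have := D.ne
  exact Function.iterate_fixed (Tavg_zero _ _) k

lemma it_norm (h : ℝ) (k : ℕ) (u : L1d d) : ‖(D.T h)^[k] u‖ ≤ ‖u‖ := by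
  have := it_contr D h k u 0
  simpa [it_zero] using this

lemma it_Bd (h : ℝ) (k : ℕ) {M : ℝ} (hM : 0 ≤ M) {u : L1d d} (hu : Bd M u) :
    Bd M ((D.T h)^[k] u) := by
  have := D.ne
  induction k with
  | zero => exact hu
  | succ k ih =>
    rw [Function.iterate_succ_apply']
    exact Tavg_Bd _ _ hM ih

lemma it_tau (h : ℝ) (k : ℕ) (z : Fin d → ℝ) (u : L1d d) :
    (D.T h)^[k] (tau z u) = tau z ((D.T h)^[k] u) := by
  have := D.ne
  induction k with
  | zero => rfl
  | succ k ih =>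
    rw [Function.iterate_succ_apply', Function.iterate_succ_apply', ih]
    exact Tavg_tau _ _ z _

/-- the weak form of the generator in kinetic variables -/
noncomputable def FPData.J (ψ : (Fin d → ℝ) → ℝ) (u : L1d d) : ℝ :=
  ∫ p, ch u p * Lgen D.β D.A ψ p ∂(kinM d)

lemma Lgen_meas {ψ : (Fin d → ℝ) → ℝ} (hψ : ContDiff ℝ 2 ψ) :
    Measurable (Lgen D.β D.A ψ) := by
  have h1 : ∀ i, Continuous (pd i ψ) := fun i =>
    (pd_contDiff (m := 1) hψ (by norm_num) i).continuous
  have h2 := pd2_cont hψ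
  have h3 := D.hβ
  have h4 := D.hA
  apply Continuous.measurable
  unfold Lgen
  refine Continuous.add (continuous_finsetSum _ fun i _ => ?_)
    (continuous_finsetSum _ fun i _ => continuous_finsetSum _ fun j _ => ?_)
  · exact ((h3 i).comp continuous_fst).mul ((h1 i).comp continuous_snd)
  · exact ((h4 i j).comp continuous_fst).mul ((h2 i j).comp continuous_snd)

lemma Lgen_bdd {ψ : (Fin d → ℝ) → ℝ} (hψ : ContDiff ℝ 2 ψ) (hc : HasCompactSupport ψ) (M : ℝ) :
    ∃ C, 0 ≤ C ∧ ∀ p : ℝ × (Fin d → ℝ), |p.1| ≤ M → |Lgen D.β D.A ψ p| ≤ C := by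
  obtain ⟨K, hK, hKb⟩ := coef_bdd D.hβ D.hA M
  obtain ⟨C1, hC1, h1⟩ := pd_bdd (hψ.of_le (by norm_num)) hc
  obtain ⟨C2, hC2, h2⟩ := pd2_bdd hψ hc
  refine ⟨d * (K * C1) + d * (d * (K * C2)), by positivity, fun p hp => ?_⟩
  exact (abs_add_le _ _).trans (add_le_add (lin_bdd hK (hKb p.1 hp).1 fun i => h1 i _)
    (quad_bdd hK (hKb p.1 hp).2 fun i j => h2 i j _))

lemma T_fine {ψ : (Fin d → ℝ) → ℝ} (hψ : ContDiff ℝ 3 ψ) (hc : HasCompactSupport ψ) (M : ℝ) :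
    ∃ C, 0 ≤ C ∧ ∀ h : ℝ, 0 < h → h ≤ 1 → ∀ u : L1d d, Bd M u →
      |(∫ x, D.T h u x * ψ x) - (∫ x, u x * ψ x) - h * D.J ψ u| ≤ C * (h * Real.sqrt h) * ‖u‖ := by
  have := D.ne
  obtain ⟨C, hC, hb⟩ := cons_fine D.hd D.hβ D.hA D.hP M hψ hc
  have hψ2 : ContDiff ℝ 2 ψ := hψ.of_le (by norm_num)
  obtain ⟨C1, hC1, h1⟩ := bdd_of_cs hψ.continuous hc
  obtain ⟨C2, hC2, h2⟩ := Lgen_bdd D hψ2 hc M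
  refine ⟨C, hC, fun h h0 h1' u hu => ?_⟩
  obtain ⟨i1, -, e1, -⟩ := Tavg_dual (Ysch D.β D.A h) (Ysch_meas D.hβ D.hA h) u hψ.continuous h1
  have i2 : Integrable (fun p => ch u p * ψ p.2) (kinM d) :=
    kin_integrable hu (hψ.continuous.measurable.comp measurable_snd) fun p _ => h1 p.2
  have i3 := kin_integrable hu (Lgen_meas D hψ2) h2
  have i12 : Integrable (fun p => ch u p * Eavg (Ysch D.β D.A h) ψ p - ch u p * ψ p.2) (kinM d) :=
    i1.sub i2
  have e1' : ∫ x, D.T h u x * ψ x = ∫ p, ch u p * Eavg (Ysch D.β D.A h) ψ p ∂(kinM d) := e1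
  rw [e1', u_dual u hψ.continuous h1, FPData.J, ← integral_sub i1 i2, ← integral_const_mul,
    ← integral_sub i12 (i3.const_mul h)]
  have := kin_bound hu (g := fun p => Eavg (Ysch D.β D.A h) ψ p - ψ p.2 - h * Lgen D.β D.A ψ p)
    (hb h h0 h1')
  convert this using 2
  refine integral_congr_ae (ae_of_all _ fun p => ?_)
  simp only
  ring

lemma J_bdd {ψ : (Fin d → ℝ) → ℝ} (hψ : ContDiff ℝ 2 ψ) (hc : HasCompactSupport ψ) (M : ℝ) :
    ∃ C, 0 ≤ C ∧ ∀ u : L1d d, Bd M u → |D.J ψ u| ≤ C * ‖u‖ := by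
  obtain ⟨C2, hC2, h2⟩ := Lgen_bdd D hψ hc M
  exact ⟨C2, hC2, fun u hu => kin_bound hu h2⟩

lemma it_crude {ψ : (Fin d → ℝ) → ℝ} (hψ : ContDiff ℝ 3 ψ) (hc : HasCompactSupport ψ) {M : ℝ}
    (hM : 0 ≤ M) :
    ∃ C, 0 ≤ C ∧ ∀ h : ℝ, 0 < h → h ≤ 1 → ∀ k : ℕ, ∀ u : L1d d, Bd M u →
      |(∫ x, (D.T h)^[k] u x * ψ x) - (∫ x, u x * ψ x)| ≤ C * (k * h) * ‖u‖ := by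
  obtain ⟨C1, hC1, h1⟩ := T_fine D hψ hc M
  obtain ⟨C2, hC2, h2⟩ := J_bdd D (hψ.of_le (by norm_num)) hc M
  refine ⟨C1 + C2, by positivity, fun h h0 h1' k u hu => ?_⟩
  induction k with
  | zero => simp
  | succ k ih =>
    rw [Function.iterate_succ_apply']
    have b := it_Bd D h k hM hu
    have n := it_norm D h k u
    set v := (D.T h)^[k] u
    have a1 := h1 h h0 h1' v b
    have a2 := h2 v b
    have hs : Real.sqrt h ≤ 1 := Real.sqrt_le_one.2 h1'
    have a3 : C1 * (h * Real.sqrt h) * ‖v‖ ≤ C1 * (h * 1) * ‖u‖ := by gcongr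
    have a4 : |h * D.J ψ v| ≤ h * (C2 * ‖u‖) := by
      rw [abs_mul, abs_of_pos h0]
      gcongr
      exact a2.trans (by gcongr)
    push_cast
    rw [abs_le] at *
    constructor <;> nlinarith [a1.1, a1.2, a4.1, a4.2, ih.1, ih.2]

lemma T_tight {η : (Fin d → ℝ) → ℝ} (hη : ContDiff ℝ 2 η) (hc : HasCompactSupport η)
    (hr : ∀ x, η x ∈ Set.Icc (0:ℝ) 1) {M : ℝ} (hM : 0 ≤ M) :
    ∃ C, 0 ≤ C ∧ ∀ r h : ℝ, 0 ≤ r → r ≤ 1 → 0 < h → h ≤ 1 → ∀ k : ℕ, ∀ u : L1d d, Bd M u →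
      ∫ x, |(D.T h)^[k] u x| * (1 - η (r • x)) ≤
        (∫ x, |u x| * (1 - η (r • x))) + C * (k * h) * r * ‖u‖ := by
  have := D.ne
  obtain ⟨C, hC, hb⟩ := cons_crude D.hd D.hβ D.hA D.hP M hη hc
  refine ⟨C, hC, fun r h hr0 hr1 h0 h1 k u hu => ?_⟩
  set ψ : (Fin d → ℝ) → ℝ := fun x => 1 - η (r • x) with hψ
  have hψc : Continuous ψ := continuous_const.sub (hη.continuous.comp (continuous_const_smul r))
  have hψ0 : ∀ x, 0 ≤ ψ x := fun x => sub_nonneg.2 (hr _).2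
  have hψ1 : ∀ x, |ψ x| ≤ 1 := fun x => by
    rw [abs_of_nonneg (hψ0 x)]; have := (hr (r • x)).1; simp only [hψ]; linarith
  induction k with
  | zero => simp
  | succ k ih =>
    rw [Function.iterate_succ_apply']
    have b := it_Bd D h k hM hu
    have n := it_norm D h k u
    set v := (D.T h)^[k] u
    obtain ⟨-, i1, -, e1⟩ := Tavg_dual (Ysch D.β D.A h) (Ysch_meas D.hβ D.hA h) v hψc hψ1
    have e2 : ∫ x, |D.T h v x| * ψ x ≤ _ := e1 hψ0
    have e3 := u_abs v hψc hψ1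
    have i2 : Integrable (fun p => |ch v p| * ψ p.2) (kinM d) := by
      have := kin_integrable b (hψc.measurable.comp measurable_snd) fun p _ => hψ1 p.2
      refine this.abs.congr (ae_of_all _ fun p => ?_)
      simp only [Function.comp, abs_mul, abs_of_nonneg (hψ0 p.2)]
    have b3 := kin_bound_abs b (C := C * h * r)
      (g := fun p => Eavg (Ysch D.β D.A h) ψ p - ψ p.2) (fun p hp => by
        have e : Eavg (Ysch D.β D.A h) ψ p - ψ p.2 =
            -(Eavg (Ysch D.β D.A h) (fun x => η (r • x)) p - η (r • p.2)) := by
          simp only [Eavg, hψ, Finset.sum_sub_distrib, mul_sub]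
          rw [avg_const]; ring
        rw [e, abs_neg]
        exact hb r h hr0 hr1 h0 h1 p hp)
    have e4 : ∫ p, |ch v p| * (Eavg (Ysch D.β D.A h) ψ p - ψ p.2) ∂(kinM d) =
        (∫ p, |ch v p| * Eavg (Ysch D.β D.A h) ψ p ∂(kinM d)) - ∫ x, |v x| * ψ x := by
      rw [e3, ← integral_sub i1 i2]
      simp only [mul_sub]
    have b4 := (abs_le.1 b3).2
    rw [e4] at b4
    have b5 : C * h * r * ‖v‖ ≤ C * h * r * ‖u‖ := by gcongr
    push_cast
    nlinarith

/-- orbit set -/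
def FPData.Orb (τ : ℝ) (u : L1d d) : Set (L1d d) :=
  {v | ∃ h : ℝ, ∃ k : ℕ, 0 < h ∧ h ≤ 1 ∧ k * h ≤ τ ∧ v = (D.T h)^[k] u}

lemma cutoff_tendsto {η : (Fin d → ℝ) → ℝ} (hη : Continuous η)
    (hr : ∀ x, η x ∈ Set.Icc (0:ℝ) 1) (h0 : η 0 = 1) (u : L1d d) :
    Tendsto (fun n : ℕ => ∫ x, |u x| * (1 - η ((1 / ((n:ℝ) + 1)) • x))) atTop (nhds 0) := by
  have : Tendsto (fun n : ℕ => ∫ x, |u x| * (1 - η ((1 / ((n:ℝ) + 1)) • x))) atTop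
      (nhds (∫ _x : Fin d → ℝ, (0:ℝ))) := by
    refine tendsto_integral_of_dominated_convergence (fun x => |u x|) ?_ (L1d_int u).abs ?_ ?_
    · intro n
      exact ((L1d_meas u).abs.mul (measurable_const.sub
        (hη.comp (continuous_const_smul _)).measurable)).aestronglyMeasurable
    · intro n
      refine ae_of_all _ fun x => ?_
      have := hr ((1 / ((n:ℝ) + 1)) • x)
      rw [Real.norm_eq_abs, abs_mul, abs_abs]
      refine mul_le_of_le_one_right (abs_nonneg _) ?_
      rw [abs_le]; constructor <;> linarith [this.1, this.2]
    · refine ae_of_all _ fun x => ?_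
      have h1 : Tendsto (fun n : ℕ => (1 / ((n:ℝ) + 1)) • x) atTop (nhds ((0:ℝ) • x)) :=
        (tendsto_one_div_add_atTop_nhds_zero_nat).smul_const x
      have h2 := (((hη.tendsto _).comp h1).const_sub 1).const_mul |u x|
      simpa [h0] using h2
  simpa using this

lemma Orb_tb_bdd (τ : ℝ) (_hτ : 0 ≤ τ) {M : ℝ} (hM : 0 ≤ M) {u : L1d d} (hu : Bd M u) :
    TotallyBounded (D.Orb τ u) := by
  refine kolmogorov_riesz _ ‖u‖ ?_ ?_ ?_
  · rintro f ⟨h, k, -, -, -, rfl⟩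
    exact it_norm D h k u
  · intro ε hε
    have := Metric.tendsto_nhds_nhds.1 (tau_tendsto u) ε hε
    obtain ⟨δ, hδ, h1⟩ := this
    refine ⟨δ, hδ, ?_⟩
    rintro z hz f ⟨h, k, -, -, -, rfl⟩
    rw [← it_tau]
    refine (it_contr D h k _ _).trans ?_
    have := h1 (x := z) (by simpa using hz)
    rw [dist_eq_norm] at this
    exact this.le
  · intro ε hε
    obtain ⟨η, hs, hc, hη, hrange, h0⟩ := exists_contDiff_tsupport_subset (n := 2)
      (Metric.ball_mem_nhds (0 : Fin d → ℝ) one_pos)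
    have hr : ∀ x, η x ∈ Set.Icc (0:ℝ) 1 := fun x => hrange ⟨x, rfl⟩
    obtain ⟨C, hC, ht⟩ := T_tight D hη hc hr hM
    have t1 := cutoff_tendsto hη.continuous hr h0 u
    have t2 : Tendsto (fun n : ℕ => C * τ * (1 / ((n:ℝ) + 1)) * ‖u‖) atTop (nhds 0) := by
      have := ((tendsto_one_div_add_atTop_nhds_zero_nat (𝕜 := ℝ)).const_mul (C * τ)).mul_const ‖u‖
      simpa using this
    have t3 := t1.add t2
    rw [add_zero] at t3
    obtain ⟨n, hn⟩ := ((tendsto_order.1 t3).2 ε hε).exists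
    set r : ℝ := 1 / ((n:ℝ) + 1) with hrdef
    have hr0 : 0 < r := by positivity
    have hr1 : r ≤ 1 := by
      rw [hrdef, div_le_one (by positivity)]; linarith [(Nat.cast_nonneg n : (0:ℝ) ≤ n)]
    refine ⟨1 / r, ?_⟩
    rintro f ⟨h, k, hh0, hh1, hk, rfl⟩
    have b := ht r h hr0.le hr1 hh0 hh1 k u hu
    set v := (D.T h)^[k] u
    have hψc : Continuous fun x : Fin d → ℝ => 1 - η (r • x) :=
      continuous_const.sub (hη.continuous.comp (continuous_const_smul r))
    have hi : Integrable fun x => |v x| * (1 - η (r • x)) := by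
      refine (L1d_int v).abs.mul_bdd (c := 1) hψc.aestronglyMeasurable (ae_of_all _ fun x => ?_)
      have := hr (r • x)
      rw [Real.norm_eq_abs, abs_le]; constructor <;> linarith [this.1, this.2]
    calc ∫⁻ x in (Metric.closedBall 0 (1 / r))ᶜ, ‖v x‖ₑ
        ≤ ∫⁻ x in (Metric.closedBall 0 (1 / r))ᶜ, ENNReal.ofReal (|v x| * (1 - η (r • x))) := by
          refine setLIntegral_mono (hi.1.aemeasurable.ennreal_ofReal |> fun _ =>
            (((L1d_meas v).abs.mul hψc.measurable).ennreal_ofReal)) fun x hx => ?_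
          have : η (r • x) = 0 := by
            apply image_eq_zero_of_notMem_tsupport
            intro hmem
            have h1 := hs hmem
            simp only [Metric.mem_ball, dist_zero_right, norm_smul, Real.norm_eq_abs,
              abs_of_pos hr0] at h1
            simp only [Set.mem_compl_iff, Metric.mem_closedBall, dist_zero_right, not_le] at hx
            rw [div_lt_iff₀ hr0] at hx
            linarith
          rw [this, sub_zero, mul_one, Real.enorm_eq_ofReal_abs]
      _ ≤ ∫⁻ x, ENNReal.ofReal (|v x| * (1 - η (r • x))) := setLIntegral_le_lintegral _ _
      _ = ENNReal.ofReal (∫ x, |v x| * (1 - η (r • x))) := by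
          rw [ofReal_integral_eq_lintegral_ofReal hi (ae_of_all _ fun x =>
            mul_nonneg (abs_nonneg _) (sub_nonneg.2 (hr _).2))]
      _ ≤ ENNReal.ofReal ε := by
          refine ENNReal.ofReal_le_ofReal (b.trans (le_trans ?_ hn.le))
          gcongr

lemma Orb_tb (τ : ℝ) (_hτ : 0 ≤ τ) (u : L1d d) : TotallyBounded (D.Orb τ u) := by
  rw [Metric.totallyBounded_iff]
  intro ε hε
  obtain ⟨v, M, hM, hv, huv⟩ := Bd_dense u (half_pos hε)
  obtain ⟨t, ht, hcov⟩ := Metric.totallyBounded_iff.1 (Orb_tb_bdd D τ _hτ hM hv) (ε / 2) (half_pos hε)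
  refine ⟨t, ht, ?_⟩
  rintro f ⟨h, k, h0, h1, hk, rfl⟩
  have := hcov ⟨h, k, h0, h1, hk, rfl⟩
  simp only [Set.mem_iUnion, Metric.mem_ball, exists_prop] at this ⊢
  obtain ⟨y, hy, hd⟩ := this
  refine ⟨y, hy, ?_⟩
  have h2 := dist_triangle ((D.T h)^[k] u) ((D.T h)^[k] v) y
  have h3 := it_contr D h k u v
  rw [← dist_eq_norm] at h3
  linarith

lemma L1d_ext_test {u v : L1d d} (h : ∀ ψ : (Fin d → ℝ) → ℝ, ContDiff ℝ 3 ψ →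
    HasCompactSupport ψ → ∫ x, u x * ψ x = ∫ x, v x * ψ x) : u = v := by
  apply Lp.ext
  refine ae_eq_of_integral_contDiff_smul_eq (L1d_int u).locallyIntegrable
    (L1d_int v).locallyIntegrable fun g hg hc => ?_
  have := h g (by exact_mod_cast contDiff_infty.1 hg 3) hc
  simpa only [smul_eq_mul, mul_comm] using this

lemma equi_bdd {M : ℝ} (hM : 0 ≤ M) {u : L1d d} (hu : Bd M u) {ε : ℝ} (hε : 0 < ε) :
    ∃ δ > 0, ∀ h : ℝ, ∀ k : ℕ, 0 < h → h ≤ 1 → k * h ≤ δ → ‖(D.T h)^[k] u - u‖ ≤ ε := by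
  by_contra hcon
  push Not at hcon
  have hpos : ∀ n : ℕ, (0:ℝ) < 1 / ((n:ℝ) + 1) := fun n => by positivity
  choose h k h0 h1 hk hn using fun n : ℕ => hcon _ (hpos n)
  have hK : IsCompact (closure (D.Orb 1 u)) :=
    (Orb_tb D 1 zero_le_one u).closure.isCompact_of_isClosed isClosed_closure
  have hmem : ∀ n, (D.T (h n))^[k n] u ∈ closure (D.Orb 1 u) := fun n =>
    subset_closure ⟨h n, k n, h0 n, h1 n, (hk n).trans (by
      rw [div_le_one (by positivity)]; linarith [(Nat.cast_nonneg n : (0:ℝ) ≤ n)]), rfl⟩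
  obtain ⟨v, -, ns, hns, hlim⟩ := hK.tendsto_subseq hmem
  have huv : v = u := by
    refine L1d_ext_test fun ψ hψ hc => ?_
    obtain ⟨C1, hC1, hb⟩ := bdd_of_cs hψ.continuous hc
    obtain ⟨C, hC, hcr⟩ := it_crude D hψ hc hM
    have l1 := ((L1d_pair_cont (d := d) hψ.continuous hb).tendsto v).comp hlim
    have l2 : Tendsto (fun n => ∫ x, (D.T (h (ns n)))^[k (ns n)] u x * ψ x) atTop
        (nhds (∫ x, u x * ψ x)) := by
      rw [tendsto_iff_norm_sub_tendsto_zero]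
      have z : Tendsto (fun n : ℕ => C * (1 / ((ns n : ℝ) + 1)) * ‖u‖) atTop (nhds 0) := by
        have := ((tendsto_one_div_add_atTop_nhds_zero_nat (𝕜 := ℝ)).comp
          hns.tendsto_atTop).const_mul C |>.mul_const ‖u‖
        simpa using this
      refine squeeze_zero (fun n => norm_nonneg _) (fun n => ?_) z
      refine (hcr (h (ns n)) (h0 _) (h1 _) (k (ns n)) u hu).trans ?_
      have := hk (ns n)
      gcongr
    exact tendsto_nhds_unique l1 l2
  have : ε ≤ ‖v - u‖ := ge_of_tendsto ((hlim.sub_const u).norm)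
    (Eventually.of_forall fun n => (hn (ns n)).le)
  rw [huv, sub_self, norm_zero] at this
  linarith

lemma equi (u : L1d d) {ε : ℝ} (hε : 0 < ε) :
    ∃ δ > 0, ∀ h : ℝ, ∀ k : ℕ, 0 < h → h ≤ 1 → k * h ≤ δ → ‖(D.T h)^[k] u - u‖ ≤ ε := by
  obtain ⟨v, M, hM, hv, huv⟩ := Bd_dense u (ε := ε / 3) (by positivity)
  obtain ⟨δ, hδ, hb⟩ := equi_bdd D hM hv (ε := ε / 3) (by positivity)
  refine ⟨δ, hδ, fun h k h0 h1 hk => ?_⟩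
  have e : (D.T h)^[k] u - u = ((D.T h)^[k] u - (D.T h)^[k] v) + ((D.T h)^[k] v - v) - (u - v) := by
    abel
  rw [e]
  have a1 := hb h k h0 h1 hk
  have a2 := it_contr D h k u v
  have a3 := norm_sub_le (((D.T h)^[k] u - (D.T h)^[k] v) + ((D.T h)^[k] v - v)) (u - v)
  have a4 := norm_add_le ((D.T h)^[k] u - (D.T h)^[k] v) ((D.T h)^[k] v - v)
  linarith

end scheme2

section semigroup
variable {d : ℕ} (D : FPData d)

/-- step sizes -/
noncomputable def hs (n : ℕ) : ℝ := 1 / ((n:ℝ) + 1)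

lemma hs_pos (n : ℕ) : 0 < hs n := by unfold hs; positivity

lemma hs_le (n : ℕ) : hs n ≤ 1 := by
  unfold hs
  rw [div_le_one (by positivity)]; linarith [(Nat.cast_nonneg n : (0:ℝ) ≤ n)]

lemma hs_tendsto : Tendsto hs atTop (nhds 0) := tendsto_one_div_add_atTop_nhds_zero_nat

/-- number of steps -/
noncomputable def ks (n : ℕ) (t : ℝ) : ℕ := ⌊t * ((n:ℝ) + 1)⌋₊

lemma ks_le (n : ℕ) {t : ℝ} (ht : 0 ≤ t) : (ks n t : ℝ) * hs n ≤ t := by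
  unfold ks hs
  rw [mul_one_div, div_le_iff₀ (by positivity)]
  exact Nat.floor_le (by positivity)

lemma ks_ge (n : ℕ) (t : ℝ) : t - hs n ≤ (ks n t : ℝ) * hs n := by
  unfold ks hs
  have := (Nat.lt_floor_add_one (t * ((n:ℝ) + 1))).le
  rw [mul_one_div, le_div_iff₀ (by positivity), sub_mul, one_div,
    inv_mul_cancel₀ (by positivity)]
  linarith

lemma ks_tendsto {t : ℝ} (ht : 0 ≤ t) : Tendsto (fun n => (ks n t : ℝ) * hs n) atTop (nhds t) := by
  have h1 : Tendsto (fun n => t - hs n) atTop (nhds t) := by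
    simpa using hs_tendsto.const_sub t
  exact tendsto_of_tendsto_of_tendsto_of_le_of_le h1 tendsto_const_nhds (fun n => ks_ge n t)
    (fun n => ks_le n ht)

lemma ks_add (n : ℕ) {t s : ℝ} (ht : 0 ≤ t) (hs : 0 ≤ s) :
    ∃ j ≤ 1, ks n (t + s) = ks n t + ks n s + j := by
  unfold ks
  rw [add_mul]
  have ha : 0 ≤ t * ((n:ℝ) + 1) := by positivity
  have hb : 0 ≤ s * ((n:ℝ) + 1) := by positivity
  set x := t * ((n:ℝ) + 1)
  set y := s * ((n:ℝ) + 1)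
  have h1 : ⌊x⌋₊ + ⌊y⌋₊ ≤ ⌊x + y⌋₊ := by
    apply Nat.le_floor
    push_cast
    linarith [Nat.floor_le ha, Nat.floor_le hb]
  have h2 : ⌊x + y⌋₊ < ⌊x⌋₊ + ⌊y⌋₊ + 2 := by
    rw [Nat.floor_lt (by positivity)]
    push_cast
    linarith [Nat.lt_floor_add_one x, Nat.lt_floor_add_one y]
  exact ⟨⌊x + y⌋₊ - (⌊x⌋₊ + ⌊y⌋₊), by omega, by omega⟩

/-- discrete approximation -/
noncomputable def FPData.W (n : ℕ) (t : ℝ) (u : L1d d) : L1d d := (D.T (hs n))^[ks n t] u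

/-- the ultrafilter -/
noncomputable abbrev UU : Ultrafilter ℕ := hyperfilter ℕ

lemma UU_le : (UU : Filter ℕ) ≤ atTop := Nat.hyperfilter_le_atTop

lemma S_exists (t : ℝ) (u : L1d d) :
    ∃ v : L1d d, 0 ≤ t → Tendsto (fun n => D.W n t u) UU (nhds v) := by
  by_cases ht : 0 ≤ t
  · have hK : IsCompact (closure (D.Orb t u)) :=
      (Orb_tb D t ht u).closure.isCompact_of_isClosed isClosed_closure
    have hmem : ∀ n, D.W n t u ∈ closure (D.Orb t u) := fun n =>
      subset_closure ⟨hs n, ks n t, hs_pos n, hs_le n, ks_le n ht, rfl⟩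
    obtain ⟨v, -, hv⟩ := hK.ultrafilter_le_nhds (UU.map fun n => D.W n t u)
      (le_principal_iff.2 (by
        change (fun n => D.W n t u) ⁻¹' closure (D.Orb t u) ∈ (UU : Filter ℕ)
        exact Filter.univ_mem' hmem))
    exact ⟨v, fun _ => hv⟩
  · exact ⟨u, fun h => absurd h ht⟩

/-- the semigroup -/
noncomputable def FPData.S (t : ℝ) (u : L1d d) : L1d d := (S_exists D t u).choose

lemma S_spec {t : ℝ} (ht : 0 ≤ t) (u : L1d d) :
    Tendsto (fun n => D.W n t u) UU (nhds (D.S t u)) := (S_exists D t u).choose_spec ht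

lemma S_zero (u : L1d d) : D.S 0 u = u := by
  refine tendsto_nhds_unique (S_spec D le_rfl u) ?_
  have : ∀ n, D.W n 0 u = u := fun n => by simp [FPData.W, ks]
  simp only [this]
  exact tendsto_const_nhds

lemma S_contr {t : ℝ} (ht : 0 ≤ t) (u v : L1d d) : ‖D.S t u - D.S t v‖ ≤ ‖u - v‖ :=
  le_of_tendsto ((S_spec D ht u).sub (S_spec D ht v)).norm
    (Eventually.of_forall fun n => it_contr D _ _ u v)

lemma S_norm {t : ℝ} (ht : 0 ≤ t) (u : L1d d) : ‖D.S t u‖ ≤ ‖u‖ :=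
  le_of_tendsto (S_spec D ht u).norm (Eventually.of_forall fun n => it_norm D _ _ u)

lemma S_Bd {t : ℝ} (ht : 0 ≤ t) {M : ℝ} (hM : 0 ≤ M) {u : L1d d} (hu : Bd M u) :
    Bd M (D.S t u) :=
  (Bd_closed M).mem_of_tendsto (S_spec D ht u) (Eventually.of_forall fun n => it_Bd D _ _ hM hu)

lemma T_tendsto (u : L1d d) : Tendsto (fun n => ‖D.T (hs n) u - u‖) atTop (nhds 0) := by
  rw [Metric.tendsto_nhds]
  intro ε hε
  obtain ⟨δ, hδ, h1⟩ := equi D u (half_pos hε)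
  filter_upwards [(tendsto_order.1 hs_tendsto).2 δ hδ] with n hn
  have := h1 (hs n) 1 (hs_pos n) (hs_le n) (by simpa using hn.le)
  rw [Function.iterate_one] at this
  simp only [dist_zero_right, norm_norm]
  linarith

lemma S_add {t s : ℝ} (ht : 0 ≤ t) (h0 : 0 ≤ s) (u : L1d d) :
    D.S (t + s) u = D.S t (D.S s u) := by
  refine tendsto_nhds_unique (S_spec D (add_nonneg ht h0) u) ?_
  have l1 := S_spec D ht (D.S s u)
  have l2 : Tendsto (fun n => D.W n (t + s) u - D.W n t (D.S s u)) UU (nhds 0) := by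
    have l3 : Tendsto (fun n => ‖D.T (hs n) u - u‖ + ‖D.W n s u - D.S s u‖) UU (nhds 0) := by
      have := ((T_tendsto D u).mono_left UU_le).add
        (tendsto_iff_norm_sub_tendsto_zero.1 (S_spec D h0 u))
      simpa using this
    refine squeeze_zero_norm (fun n => ?_) l3
    obtain ⟨j, hj, e⟩ := ks_add n ht h0
    have e1 : D.W n (t + s) u = (D.T (hs n))^[ks n t] ((D.T (hs n))^[ks n s] ((D.T (hs n))^[j] u)) := by
      rw [FPData.W, e, Function.iterate_add_apply, Function.iterate_add_apply]
    have e2 : ‖(D.T (hs n))^[j] u - u‖ ≤ ‖D.T (hs n) u - u‖ := by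
      interval_cases j <;> simp
    have b1 := (it_contr D (hs n) (ks n t) ((D.T (hs n))^[ks n s] ((D.T (hs n))^[j] u))
      ((D.T (hs n))^[ks n s] u)).trans (it_contr D (hs n) (ks n s) ((D.T (hs n))^[j] u) u)
    have b2 := it_contr D (hs n) (ks n t) ((D.T (hs n))^[ks n s] u) (D.S s u)
    rw [e1]
    have tr := norm_sub_le_norm_sub_add_norm_sub
      ((D.T (hs n))^[ks n t] ((D.T (hs n))^[ks n s] ((D.T (hs n))^[j] u)))
      ((D.T (hs n))^[ks n t] ((D.T (hs n))^[ks n s] u))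
      (D.W n t (D.S s u))
    exact tr.trans (add_le_add (b1.trans e2) b2)
  have := l2.add l1
  simpa using this

lemma S_small (u : L1d d) {ε : ℝ} (hε : 0 < ε) :
    ∃ δ > 0, ∀ t, 0 ≤ t → t ≤ δ → ‖D.S t u - u‖ ≤ ε := by
  obtain ⟨δ, hδ, h1⟩ := equi D u hε
  refine ⟨δ, hδ, fun t ht htδ => ?_⟩
  exact le_of_tendsto ((S_spec D ht u).sub_const u).norm (Eventually.of_forall fun n =>
    h1 (hs n) (ks n t) (hs_pos n) (hs_le n) ((ks_le n ht).trans htδ))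

lemma S_diff {t s : ℝ} (ht : 0 ≤ t) (hs : t ≤ s) (u : L1d d) :
    ‖D.S s u - D.S t u‖ ≤ ‖D.S (s - t) u - u‖ := by
  have e : D.S s u = D.S t (D.S (s - t) u) := by
    rw [← S_add D ht (by linarith)]; congr 1; ring
  rw [e]
  exact S_contr D ht _ _

lemma S_cont (u : L1d d) : ContinuousOn (fun t => D.S t u) (Set.Ici 0) := by
  rw [Metric.continuousOn_iff]
  intro s hs ε hε
  obtain ⟨δ, hδ, h1⟩ := S_small D u (half_pos hε)
  refine ⟨δ, hδ, fun t ht hts => ?_⟩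
  rw [Real.dist_eq] at hts
  rw [dist_eq_norm]
  have hlt := abs_lt.1 hts
  rcases le_total s t with h | h
  · have a := S_diff D hs h u
    have b := h1 (t - s) (by linarith) (by linarith)
    linarith
  · have a := S_diff D ht h u
    have b := h1 (s - t) (by linarith) (by linarith)
    rw [norm_sub_rev]
    linarith

lemma ch_sub_norm (u v : L1d d) : ∫ p, |ch u p - ch v p| ∂(kinM d) = ‖u - v‖ := by
  have i : Integrable (fun p => |ch u p - ch v p|) (kinM d) := ((ch_int u).sub (ch_int v)).abs
  rw [integral_prod_symm _ i, L1d_norm_sub]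
  refine integral_congr_ae (ae_of_all _ fun x => ?_)
  have h := lintegral_chi_sub (u x) (v x)
  simp only [ch]
  have h2 : ∫ ξ, |chi ξ (u x) - chi ξ (v x)| = (∫⁻ ξ, ‖chi ξ (u x) - chi ξ (v x)‖ₑ).toReal := by
    rw [← integral_norm_eq_lintegral_enorm]
    · rfl
    · exact ((chi_integrable (u x)).sub (chi_integrable (v x))).aestronglyMeasurable
  rw [h2, h]
  simp

lemma J_lip {ψ : (Fin d → ℝ) → ℝ} (hψ : ContDiff ℝ 2 ψ) (hc : HasCompactSupport ψ) (M : ℝ) :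
    ∃ C, 0 ≤ C ∧ ∀ u v : L1d d, Bd M u → Bd M v → |D.J ψ u - D.J ψ v| ≤ C * ‖u - v‖ := by
  obtain ⟨C, hC, hb⟩ := Lgen_bdd D hψ hc M
  refine ⟨C, hC, fun u v hu hv => ?_⟩
  have i1 := kin_integrable hu (Lgen_meas D hψ) hb
  have i2 := kin_integrable hv (Lgen_meas D hψ) hb
  rw [FPData.J, FPData.J, ← integral_sub i1 i2, ← ch_sub_norm, ← integral_const_mul,
    ← Real.norm_eq_abs]
  refine norm_integral_le_of_norm_le (((ch_int u).sub (ch_int v)).abs.const_mul C) ?_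
  filter_upwards [ch_bd hu, ch_bd hv] with p h1 h2
  rw [← sub_mul, Real.norm_eq_abs, abs_mul, mul_comm]
  change _ ≤ C * |ch u p - ch v p|
  by_cases h0 : ch u p = 0
  · by_cases h0' : ch v p = 0
    · simp [h0, h0']
    · gcongr
      exact hb p (h2 h0')
  · gcongr
    exact hb p (h1 h0)

lemma S_deriv {ψ : (Fin d → ℝ) → ℝ} (hψ : ContDiff ℝ 3 ψ) (hc : HasCompactSupport ψ) {M : ℝ}
    (hM : 0 ≤ M) {u : L1d d} (hu : Bd M u) {ε : ℝ} (hε : 0 < ε) :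
    ∃ δ > 0, ∀ t, 0 ≤ t → t ≤ δ →
      |(∫ x, D.S t u x * ψ x) - (∫ x, u x * ψ x) - t * D.J ψ u| ≤ t * ε := by
  obtain ⟨C1, hC1, h1⟩ := T_fine D hψ hc M
  obtain ⟨C2, hC2, h2⟩ := J_lip D (hψ.of_le (by norm_num)) hc M
  obtain ⟨δ, hδ, heq⟩ := equi D u (ε := ε / (C2 + 1)) (by positivity)
  refine ⟨δ, hδ, fun t ht htδ => ?_⟩
  have key : ∀ h : ℝ, 0 < h → h ≤ 1 → ∀ k : ℕ, k * h ≤ δ →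
      |(∫ x, (D.T h)^[k] u x * ψ x) - (∫ x, u x * ψ x) - (k * h) * D.J ψ u| ≤
        (k * h) * (ε + C1 * Real.sqrt h * ‖u‖) := by
    intro h h0 hh1 k
    induction k with
    | zero => intro _; simp
    | succ k ih =>
      intro hk
      push_cast at hk
      have hk' : (k:ℝ) * h ≤ δ := by nlinarith
      have ih' := ih hk'
      rw [Function.iterate_succ_apply']
      have b := it_Bd D h k hM hu
      have n := it_norm D h k u
      have q := heq h k h0 hh1 hk'
      set v := (D.T h)^[k] u
      have a1 := h1 h h0 hh1 v b
      have a2 := h2 v u b hu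
      have a3 : C1 * (h * Real.sqrt h) * ‖v‖ ≤ h * (C1 * Real.sqrt h * ‖u‖) := by
        calc C1 * (h * Real.sqrt h) * ‖v‖ ≤ C1 * (h * Real.sqrt h) * ‖u‖ := by gcongr
          _ = _ := by ring
      have a4 : C2 * ‖v - u‖ ≤ ε := by
        calc C2 * ‖v - u‖ ≤ (C2 + 1) * (ε / (C2 + 1)) := by gcongr; linarith
          _ = ε := by field_simp
      have a5 : |h * D.J ψ v - h * D.J ψ u| ≤ h * ε := by
        rw [← mul_sub, abs_mul, abs_of_pos h0]
        gcongr
        exact a2.trans a4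
      push_cast
      rw [abs_le] at *
      constructor
      · linarith [a1.1, a5.1, ih'.1]
      · linarith [a1.2, a5.2, ih'.2]
  obtain ⟨Cψ, -, hb⟩ := bdd_of_cs hψ.continuous hc
  have l1 : Tendsto (fun n => ∫ x, D.W n t u x * ψ x) UU (nhds (∫ x, D.S t u x * ψ x)) :=
    ((L1d_pair_cont (d := d) hψ.continuous hb).tendsto _).comp (S_spec D ht u)
  have l2 := (ks_tendsto ht).mono_left UU_le
  have l3 : Tendsto (fun n => Real.sqrt (hs n)) UU (nhds 0) := by
    have := ((Real.continuous_sqrt.tendsto 0).comp hs_tendsto).mono_left UU_le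
    rw [Real.sqrt_zero] at this
    exact this
  have L := ((l1.sub_const (∫ x, u x * ψ x)).sub (l2.mul_const (D.J ψ u))).abs
  have R := l2.mul (((l3.const_mul C1).mul_const ‖u‖).const_add ε)
  simp only [mul_zero, zero_mul, add_zero] at R
  exact le_of_tendsto_of_tendsto L R (Eventually.of_forall fun n =>
    key (hs n) (hs_pos n) (hs_le n) (ks n t) ((ks_le n ht).trans htδ))

end semigroup

section slices
variable {d : ℕ}

lemma pdx_slice {φ : ℝ × (Fin d → ℝ) → ℝ} (h : Differentiable ℝ φ) (i : Fin d) (t : ℝ)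
    (x : Fin d → ℝ) : pd i (fun y => φ (t, y)) x = pdx i φ (t, x) := by
  have h1 : HasFDerivAt (fun y : Fin d → ℝ => φ (t, y))
      ((fderiv ℝ φ (t, x)).comp (ContinuousLinearMap.inr ℝ ℝ (Fin d → ℝ))) x :=
    HasFDerivAt.comp x (h (t, x)).hasFDerivAt (hasFDerivAt_prodMk_right t x)
  rw [pd, h1.fderiv]
  rfl

lemma pdw_contDiff {V : Type*} [NormedAddCommGroup V] [NormedSpace ℝ V] {φ : V → ℝ}
    {n m : WithTop ℕ∞} (h : ContDiff ℝ n φ) (hm : m + 1 ≤ n)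
    (w : V) : ContDiff ℝ m (fun p => fderiv ℝ φ p w) :=
  (h.fderiv_right hm).clm_apply contDiff_const

lemma pdxx_slice {φ : ℝ × (Fin d → ℝ) → ℝ} (h : ContDiff ℝ 2 φ) (i j : Fin d) (t : ℝ)
    (x : Fin d → ℝ) : pd2 i j (fun y => φ (t, y)) x = pdxx i j φ (t, x) := by
  have h1 : pd j (fun y => φ (t, y)) = fun y => pdx j φ (t, y) := by
    funext y
    exact pdx_slice (h.differentiable (by norm_num)) j t y
  rw [pd2, h1, pdxx]
  refine pdx_slice ?_ i t x
  exact (pdw_contDiff (m := 1) h (by norm_num) _).differentiable (by norm_num)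

lemma slice_cs {φ : ℝ × (Fin d → ℝ) → ℝ} (hc : HasCompactSupport φ) (t : ℝ) :
    HasCompactSupport (fun y => φ (t, y)) := by
  refine HasCompactSupport.intro (hc.isCompact.image continuous_snd) fun x hx => ?_
  by_contra h
  exact hx ⟨(t, x), subset_tsupport _ h, rfl⟩

lemma slice_contDiff {φ : ℝ × (Fin d → ℝ) → ℝ} {n : WithTop ℕ∞} (h : ContDiff ℝ n φ) (t : ℝ) :
    ContDiff ℝ n (fun y => φ (t, y)) := h.comp (contDiff_const.prodMk contDiff_id)

lemma pair_time_cont {Φ : ℝ × (Fin d → ℝ) → ℝ} (hΦ : Continuous Φ) {C : ℝ} (hC : ∀ p, |Φ p| ≤ C)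
    {v : ℝ → L1d d} {s : Set ℝ} (hv : ContinuousOn v s) :
    ContinuousOn (fun t => ∫ x, v t x * Φ (t, x)) s := by
  intro t0 ht0
  have hs : ∀ t, Continuous fun x => Φ (t, x) := fun t => by fun_prop
  have h1 : ∀ t, ∫ x, v t x * Φ (t, x) =
      (∫ x, (v t - v t0 : L1d d) x * Φ (t, x)) + ∫ x, v t0 x * Φ (t, x) := by
    intro t
    have := L1d_pair_sub (v t) (v t0) (hs t) (fun x => hC (t, x))
    linarith
  have h2 : Continuous fun t => ∫ x, v t0 x * Φ (t, x) := by
    refine continuous_of_dominated (bound := fun x => |v t0 x| * C) ?_ ?_ ?_ ?_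
    · intro t
      exact (L1d_pair_int (v t0) (hs t) (fun x => hC (t, x))).aestronglyMeasurable
    · intro t
      refine ae_of_all _ fun x => ?_
      rw [Real.norm_eq_abs, abs_mul]
      exact mul_le_mul_of_nonneg_left (hC _) (abs_nonneg _)
    · exact (L1d_int (v t0)).abs.mul_const C
    · exact ae_of_all _ fun x => by fun_prop
  have h3 : Tendsto (fun t => ∫ x, (v t - v t0 : L1d d) x * Φ (t, x)) (nhdsWithin t0 s) (nhds 0) := by
    refine squeeze_zero_norm (a := fun t => C * ‖v t - v t0‖) (fun t => ?_) ?_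
    · exact L1d_pair_le _ (fun x => hC (t, x))
    · have := (tendsto_iff_norm_sub_tendsto_zero.1 (hv t0 ht0)).const_mul C
      rwa [mul_zero] at this
  have := h3.add (h2.continuousWithinAt (s := s) (x := t0))
  rw [zero_add] at this
  exact this.congr fun t => (h1 t).symm

end slices

/-- coefficients of the Fokker-Planck equation with bounds -/
structure FPCoef (d : ℕ) where
  /-- diffusion -/
  a : Fin d → Fin d → ℝ → ℝ
  /-- drift -/
  b : Fin d → ℝ → ℝ
  /-- bounds -/
  Ca : Fin d → Fin d → ℝ
  /-- bounds -/
  Cb : Fin d → ℝ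
  hd : 1 ≤ d
  ha : ∀ i j, ContDiff ℝ 1 (a i j)
  hCa : ∀ i j r, |a i j r| ≤ Ca i j
  hsym : ∀ i j r, a i j r = a j i r
  hpsd : ∀ (r : ℝ) (ξ : Fin d → ℝ), 0 ≤ ∑ i, ∑ j, (a i j r + r * deriv (a i j) r) * ξ i * ξ j
  hb : ∀ i, ContDiff ℝ 1 (b i)
  hCb : ∀ i r, |b i r| ≤ Cb i

lemma cderiv_cont {c : ℝ → ℝ} (hc : ContDiff ℝ 1 c) : Continuous fun r => c r + r * deriv c r :=
  hc.continuous.add (continuous_id.mul (hc.continuous_deriv le_rfl))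

/-- kinetic data of the coefficients -/
noncomputable def FPCoef.D {d : ℕ} (Q : FPCoef d) : FPData d where
  β := fun i r => Q.b i r + r * deriv (Q.b i) r
  A := fun r i j => Q.a i j r + r * deriv (Q.a i j) r
  hd := Q.hd
  hβ := fun i => cderiv_cont (Q.hb i)
  hA := fun i j => cderiv_cont (Q.ha i j)
  hP := fun r => ⟨fun i j => by
    have : Q.a i j = Q.a j i := funext (Q.hsym i j)
    simp only [this], Q.hpsd r⟩

section coef
variable {d : ℕ}

lemma kin_term_int {c : ℝ → ℝ} (hc : ContDiff ℝ 1 c) {M : ℝ} {u : L1d d} (hu : Bd M u)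
    {f : (Fin d → ℝ) → ℝ} (hf : Continuous f) {C : ℝ} (hC : ∀ x, |f x| ≤ C) :
    Integrable (fun p => ch u p * ((c p.1 + p.1 * deriv c p.1) * f p.2)) (kinM d) := by
  obtain ⟨K, -, hK⟩ := cont_bdd_Icc (cderiv_cont hc) M
  have hC0 : 0 ≤ C := (abs_nonneg _).trans (hC 0)
  refine kin_integrable (C := |K| * C) hu ?_ fun p hp => ?_
  · exact (((cderiv_cont hc).comp continuous_fst).mul (hf.comp continuous_snd)).measurable
  · rw [abs_mul]
    refine mul_le_mul ?_ (hC _) (abs_nonneg _) (abs_nonneg _)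
    refine le_trans ?_ (le_abs_self K)
    exact hK _ hp

lemma kin_term {c : ℝ → ℝ} (hc : ContDiff ℝ 1 c) {M : ℝ} {u : L1d d} (hu : Bd M u)
    {f : (Fin d → ℝ) → ℝ} (hf : Continuous f) {C : ℝ} (hC : ∀ x, |f x| ≤ C) :
    ∫ p, ch u p * ((c p.1 + p.1 * deriv c p.1) * f p.2) ∂(kinM d) =
      ∫ x, c (u x) * u x * f x := by
  rw [integral_prod_symm _ (kin_term_int hc hu hf hC)]
  refine integral_congr_ae (ae_of_all _ fun x => ?_)
  simp only [ch]
  have h1 : ∀ ξ, chi ξ (u x) * ((c ξ + ξ * deriv c ξ) * f x) =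
      (chi ξ (u x) * (c ξ + ξ * deriv c ξ)) * f x := fun ξ => by ring
  simp only [h1]
  rw [integral_mul_const, integral_chi_mul _ _ (cderiv_cont hc)]
  congr 1
  have h2 : ∀ r ∈ Set.uIcc 0 (u x), HasDerivAt (fun r => c r * r) (c r + r * deriv c r) r := by
    intro r _
    have := ((hc.differentiable one_ne_zero r).hasDerivAt).mul (hasDerivAt_id r)
    refine this.congr_deriv ?_
    simp only [id_eq]; ring
  rw [intervalIntegral.integral_eq_sub_of_hasDerivAt h2 ((cderiv_cont hc).intervalIntegrable _ _)]
  simp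

variable (Q : FPCoef d)

lemma J_eq {ψ : (Fin d → ℝ) → ℝ} (hψ : ContDiff ℝ 2 ψ) (hc : HasCompactSupport ψ) {M : ℝ}
    {u : L1d d} (hu : Bd M u) :
    Q.D.J ψ u = (∑ i, ∑ j, ∫ x, Q.a i j (u x) * u x * pd2 i j ψ x) +
      ∑ i, ∫ x, Q.b i (u x) * u x * pd i ψ x := by
  obtain ⟨C1, -, h1⟩ := pd_bdd (hψ.of_le (by norm_num)) hc
  obtain ⟨C2, -, h2⟩ := pd2_bdd hψ hc
  have c1 : ∀ i, Continuous (pd i ψ) := fun i => (pd_contDiff (m := 1) hψ (by norm_num) i).continuous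
  have i1 := fun i => kin_term_int (Q.hb i) hu (c1 i) (h1 i)
  have i2 := fun i j => kin_term_int (Q.ha i j) hu (pd2_cont hψ i j) (h2 i j)
  have e1 := fun i => kin_term (Q.hb i) hu (c1 i) (h1 i)
  have e2 := fun i j => kin_term (Q.ha i j) hu (pd2_cont hψ i j) (h2 i j)
  simp only [← e1, ← e2]
  simp only [← integral_finsetSum _ fun j _ => i2 _ j]
  rw [← integral_finsetSum _ fun i _ => integrable_finsetSum _ fun j _ => i2 i j,
    ← integral_finsetSum _ fun i _ => i1 i, ← integral_add
      (integrable_finsetSum _ fun i _ => integrable_finsetSum _ fun j _ => i2 i j)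
      (integrable_finsetSum _ fun i _ => i1 i)]
  refine integral_congr_ae (ae_of_all _ fun p => ?_)
  simp only [Lgen, FPCoef.D, mul_add, Finset.mul_sum]
  rw [add_comm]

/-- Nemytskii operators -/
noncomputable def FPCoef.Na (i j : Fin d) (u : L1d d) : L1d d :=
  Nem (Q.a i j) (Q.ha i j).continuous (Q.Ca i j) (Q.hCa i j) u

/-- Nemytskii operators -/
noncomputable def FPCoef.Nb (i : Fin d) (u : L1d d) : L1d d :=
  Nem (Q.b i) (Q.hb i).continuous (Q.Cb i) (Q.hCb i) u

lemma Na_cont (i j : Fin d) : Continuous (Q.Na i j) :=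
  Nem_cont (Q.ha i j).continuous (Q.hCa i j)
lemma Nb_cont (i : Fin d) : Continuous (Q.Nb i) :=
  Nem_cont (Q.hb i).continuous (Q.hCb i)

lemma Na_pair (i j : Fin d) (u : L1d d) (f : (Fin d → ℝ) → ℝ) :
    ∫ x, Q.Na i j u x * f x = ∫ x, Q.a i j (u x) * u x * f x := by
  refine integral_congr_ae ?_
  filter_upwards [Nem_coe (Q.ha i j).continuous (Q.hCa i j) u] with x hx
  simp only [FPCoef.Na, hx]

lemma Nb_pair (i : Fin d) (u : L1d d) (f : (Fin d → ℝ) → ℝ) :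
    ∫ x, Q.Nb i u x * f x = ∫ x, Q.b i (u x) * u x * f x := by
  refine integral_congr_ae ?_
  filter_upwards [Nem_coe (Q.hb i).continuous (Q.hCb i) u] with x hx
  simp only [FPCoef.Nb, hx]

/-- the spatial integral in the weak formulation -/
noncomputable def FPCoef.GG (φ : ℝ × (Fin d → ℝ) → ℝ) (t : ℝ) (u : L1d d) : ℝ :=
  ∫ x, (u x * pdt φ (t, x)
      + ∑ i, ∑ j, Q.a i j (u x) * u x * pdxx i j φ (t, x)
      + u x * ∑ i, Q.b i (u x) * pdx i φ (t, x))

variable {φ : ℝ × (Fin d → ℝ) → ℝ}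

lemma pdt_cont (hφ : ContDiff ℝ 3 φ) : Continuous (pdt φ) :=
  (pdw_contDiff (m := 2) hφ (by norm_num) _).continuous

lemma pdx_contDiff (hφ : ContDiff ℝ 3 φ) (i : Fin d) : ContDiff ℝ 2 (pdx i φ) :=
  pdw_contDiff (m := 2) hφ (by norm_num) _

lemma pdxx_cont (hφ : ContDiff ℝ 3 φ) (i j : Fin d) : Continuous (pdxx i j φ) :=
  (pdw_contDiff (m := 1) (pdx_contDiff hφ j) (by norm_num) _).continuous

lemma pdt_sub (φ : ℝ × (Fin d → ℝ) → ℝ) : tsupport (pdt φ) ⊆ tsupport φ := tsupport_fderiv_apply_subset ℝ _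
lemma pdx_sub (φ : ℝ × (Fin d → ℝ) → ℝ) (i : Fin d) : tsupport (pdx i φ) ⊆ tsupport φ :=
  tsupport_fderiv_apply_subset ℝ _
lemma pdxx_sub (φ : ℝ × (Fin d → ℝ) → ℝ) (i j : Fin d) : tsupport (pdxx i j φ) ⊆ tsupport φ :=
  (pdx_sub _ i).trans (pdx_sub φ j)

lemma cs_of_sub {f g : ℝ × (Fin d → ℝ) → ℝ} (hc : HasCompactSupport f) (h : tsupport g ⊆ tsupport f) :
    HasCompactSupport g := hc.isCompact.of_isClosed_subset (isClosed_tsupport _) h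

lemma phi_bdds (hφ : ContDiff ℝ 3 φ) (hc : HasCompactSupport φ) : ∃ C, 0 ≤ C ∧
    (∀ p, |pdt φ p| ≤ C) ∧ (∀ i p, |pdx i φ p| ≤ C) ∧ (∀ i j p, |pdxx i j φ p| ≤ C) := by
  obtain ⟨C1, h1, hC1⟩ := bdd_of_cs (pdt_cont hφ) (cs_of_sub hc (pdt_sub φ))
  choose C2 h2 hC2 using fun i => bdd_of_cs (pdx_contDiff hφ i).continuous (cs_of_sub hc (pdx_sub φ i))
  choose C3 h3 hC3 using fun i j => bdd_of_cs (pdxx_cont hφ i j) (cs_of_sub hc (pdxx_sub φ i j))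
  have s2 : 0 ≤ ∑ i, C2 i := Finset.sum_nonneg fun i _ => h2 i
  have s3 : 0 ≤ ∑ i, ∑ j, C3 i j := Finset.sum_nonneg fun i _ => Finset.sum_nonneg fun j _ => h3 i j
  refine ⟨C1 + (∑ i, C2 i) + ∑ i, ∑ j, C3 i j, by positivity, fun p => ?_, fun i p => ?_,
    fun i j p => ?_⟩
  · have := hC1 p
    linarith
  · have := hC2 i p
    have := Finset.single_le_sum (f := C2) (fun i _ => h2 i) (Finset.mem_univ i)
    linarith
  · have := hC3 i j p
    have := Finset.single_le_sum (f := C3 i) (fun j _ => h3 i j) (Finset.mem_univ j)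
    have := Finset.single_le_sum (f := fun i => ∑ j, C3 i j)
      (fun i _ => Finset.sum_nonneg fun j _ => h3 i j) (Finset.mem_univ i)
    linarith

lemma GG_split (hφ : ContDiff ℝ 3 φ) (hc : HasCompactSupport φ) (t : ℝ) (u : L1d d) :
    Q.GG φ t u = (∫ x, u x * pdt φ (t, x)) +
      ((∑ i, ∑ j, ∫ x, Q.Na i j u x * pdxx i j φ (t, x)) +
        ∑ i, ∫ x, Q.Nb i u x * pdx i φ (t, x)) := by
  obtain ⟨C, hC, b1, b2, b3⟩ := phi_bdds hφ hc
  have k : ∀ {Φ : ℝ × (Fin d → ℝ) → ℝ}, Continuous Φ → Continuous fun x => Φ (t, x) :=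
    fun h => h.comp (by fun_prop)
  have i0 := L1d_pair_int u (k (pdt_cont hφ)) (fun x => b1 (t, x))
  have i1 := fun i => L1d_pair_int (Q.Nb i u) (k (pdx_contDiff hφ i).continuous) (fun x => b2 i (t, x))
  have i2 := fun i j => L1d_pair_int (Q.Na i j u) (k (pdxx_cont hφ i j)) (fun x => b3 i j (t, x))
  have i3 : Integrable (fun x => (∑ i, ∑ j, Q.Na i j u x * pdxx i j φ (t, x)) +
      ∑ i, Q.Nb i u x * pdx i φ (t, x)) :=
    (integrable_finsetSum _ fun i _ => integrable_finsetSum _ fun j _ => i2 i j).add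
      (integrable_finsetSum _ fun i _ => i1 i)
  simp only [← integral_finsetSum _ fun j _ => i2 _ j]
  rw [← integral_finsetSum _ fun i _ => integrable_finsetSum _ fun j _ => i2 i j,
    ← integral_finsetSum _ fun i _ => i1 i, ← integral_add
      (integrable_finsetSum _ fun i _ => integrable_finsetSum _ fun j _ => i2 i j)
      (integrable_finsetSum _ fun i _ => i1 i), ← integral_add i0 i3]
  refine integral_congr_ae ?_
  filter_upwards [ae_all_iff.2 fun i => ae_all_iff.2 fun j =>
      Nem_coe (Q.ha i j).continuous (Q.hCa i j) u,
    ae_all_iff.2 fun i => Nem_coe (Q.hb i).continuous (Q.hCb i) u] with x h1 h2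
  simp only [FPCoef.Na, FPCoef.Nb, h1, h2, Finset.mul_sum, add_assoc]
  congr 2
  refine Finset.sum_congr rfl fun i _ => ?_
  ring

lemma GG_J (hφ : ContDiff ℝ 3 φ) (hc : HasCompactSupport φ) (t : ℝ) {M : ℝ} {u : L1d d}
    (hu : Bd M u) :
    Q.GG φ t u = (∫ x, u x * pdt φ (t, x)) + Q.D.J (fun y => φ (t, y)) u := by
  rw [GG_split Q hφ hc, J_eq Q (slice_contDiff (hφ.of_le (by norm_num)) t) (slice_cs hc t) hu]
  simp only [Na_pair, Nb_pair, pdx_slice (hφ.differentiable (by norm_num)),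
    pdxx_slice (hφ.of_le (by norm_num : (2 : WithTop ℕ∞) ≤ 3))]

lemma GG_timecont (hφ : ContDiff ℝ 3 φ) (hc : HasCompactSupport φ) {v : ℝ → L1d d} {s : Set ℝ}
    (hv : ContinuousOn v s) : ContinuousOn (fun t => Q.GG φ t (v t)) s := by
  obtain ⟨C, hC, b1, b2, b3⟩ := phi_bdds hφ hc
  simp only [GG_split Q hφ hc]
  refine (pair_time_cont (pdt_cont hφ) b1 hv).add (ContinuousOn.add ?_ ?_)
  · refine continuousOn_finsetSum _ fun i _ => continuousOn_finsetSum _ fun j _ => ?_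
    exact pair_time_cont (pdxx_cont hφ i j) (b3 i j) ((Na_cont Q i j).comp_continuousOn hv)
  · refine continuousOn_finsetSum _ fun i _ => ?_
    exact pair_time_cont (pdx_contDiff hφ i).continuous (b2 i) ((Nb_cont Q i).comp_continuousOn hv)

lemma GG_cont (hφ : ContDiff ℝ 3 φ) (hc : HasCompactSupport φ) (t : ℝ) :
    Continuous (Q.GG φ t) := by
  obtain ⟨C, hC, b1, b2, b3⟩ := phi_bdds hφ hc
  have k : ∀ {Φ : ℝ × (Fin d → ℝ) → ℝ}, Continuous Φ → Continuous fun x => Φ (t, x) :=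
    fun h => h.comp (by fun_prop)
  have : Q.GG φ t = fun u => _ := funext fun u => GG_split Q hφ hc t u
  rw [this]
  refine (L1d_pair_cont (k (pdt_cont hφ)) (fun x => b1 (t, x))).add (Continuous.add ?_ ?_)
  · refine continuous_finsetSum _ fun i _ => continuous_finsetSum _ fun j _ => ?_
    exact (L1d_pair_cont (k (pdxx_cont hφ i j)) (fun x => b3 i j (t, x))).comp (Na_cont Q i j)
  · refine continuous_finsetSum _ fun i _ => ?_
    exact (L1d_pair_cont (k (pdx_contDiff hφ i).continuous) (fun x => b2 i (t, x))).comp (Nb_cont Q i)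

lemma GG_bdd (hφ : ContDiff ℝ 3 φ) (hc : HasCompactSupport φ) :
    ∃ K, 0 ≤ K ∧ ∀ t u, |Q.GG φ t u| ≤ K * ‖u‖ := by
  obtain ⟨C, hC, b1, b2, b3⟩ := phi_bdds hφ hc
  have pa : ∀ i j, 0 ≤ Q.Ca i j := fun i j => (abs_nonneg _).trans (Q.hCa i j 0)
  have pb : ∀ i, 0 ≤ Q.Cb i := fun i => (abs_nonneg _).trans (Q.hCb i 0)
  refine ⟨C + ((∑ i, ∑ j, C * Q.Ca i j) + ∑ i, C * Q.Cb i), ?_, fun t u => ?_⟩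
  · refine add_nonneg hC (add_nonneg ?_ ?_)
    · exact Finset.sum_nonneg fun i _ => Finset.sum_nonneg fun j _ => mul_nonneg hC (pa i j)
    · exact Finset.sum_nonneg fun i _ => mul_nonneg hC (pb i)
  · rw [GG_split Q hφ hc, add_mul, add_mul, Finset.sum_mul, Finset.sum_mul]
    simp only [Finset.sum_mul]
    refine (abs_add_le _ _).trans (add_le_add (L1d_pair_le u fun x => b1 (t, x)) ?_)
    refine (abs_add_le _ _).trans (add_le_add ?_ ?_)
    · refine (Finset.abs_sum_le_sum_abs _ _).trans (Finset.sum_le_sum fun i _ => ?_)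
      refine (Finset.abs_sum_le_sum_abs _ _).trans (Finset.sum_le_sum fun j _ => ?_)
      refine (L1d_pair_le _ fun x => b3 i j (t, x)).trans ?_
      rw [mul_assoc]
      exact mul_le_mul_of_nonneg_left (Nem_norm _ _ u) hC
    · refine (Finset.abs_sum_le_sum_abs _ _).trans (Finset.sum_le_sum fun i _ => ?_)
      refine (L1d_pair_le _ fun x => b2 i (t, x)).trans ?_
      rw [mul_assoc]
      exact mul_le_mul_of_nonneg_left (Nem_norm _ _ u) hC

lemma GG_zero {t : ℝ} (h : ∀ x, (t, x) ∉ tsupport φ) (u : L1d d) : Q.GG φ t u = 0 := by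
  have z0 : ∀ x, pdt φ (t, x) = 0 := fun x => image_eq_zero_of_notMem_tsupport fun k => h x (pdt_sub φ k)
  have z1 : ∀ i x, pdx i φ (t, x) = 0 := fun i x =>
    image_eq_zero_of_notMem_tsupport fun k => h x (pdx_sub φ i k)
  have z2 : ∀ i j x, pdxx i j φ (t, x) = 0 := fun i j x =>
    image_eq_zero_of_notMem_tsupport fun k => h x (pdxx_sub φ i j k)
  simp [FPCoef.GG, z0, z1, z2]

end coef

section final
variable {d : ℕ} (Q : FPCoef d) {φ : ℝ × (Fin d → ℝ) → ℝ}

lemma g_deriv (hφ : ContDiff ℝ 3 φ) (hc : HasCompactSupport φ) {M : ℝ} (hM : 0 ≤ M) {u : L1d d}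
    (hu : Bd M u) {t : ℝ} (ht : 0 ≤ t) :
    HasDerivWithinAt (fun t => ∫ x, Q.D.S t u x * φ (t, x)) (Q.GG φ t (Q.D.S t u)) (Set.Ioi t) t := by
  obtain ⟨C1, hC1, b1⟩ := taylor_one φ (hφ.of_le (by norm_num)) hc
  obtain ⟨C2, hC2, b2, -, -⟩ := phi_bdds hφ hc
  obtain ⟨C3, hC3, b3⟩ := bdd_of_cs hφ.continuous hc
  have hB := S_Bd Q.D ht hM hu
  rw [hasDerivWithinAt_iff_isLittleO, Asymptotics.isLittleO_iff]
  intro c hc0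
  obtain ⟨δ, hδ, h1⟩ := S_deriv Q.D (slice_contDiff hφ t) (slice_cs hc t) hM hB
    (ε := c / 3) (by positivity)
  have hcont : Tendsto (fun r => ‖Q.D.S r u - Q.D.S t u‖) (nhdsWithin t (Set.Ioi t)) (nhds 0) :=
    tendsto_iff_norm_sub_tendsto_zero.1 ((S_cont Q.D u t ht).mono_left
      (nhdsWithin_mono _ fun r hr => ht.trans (le_of_lt hr)))
  have e1 : ∀ᶠ r in nhdsWithin t (Set.Ioi t), ‖Q.D.S r u - Q.D.S t u‖ < c / 3 / (C2 + 1) :=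
    hcont.eventually_lt_const (by positivity)
  have e2 : ∀ᶠ r in nhdsWithin t (Set.Ioi t), r < t + min δ (c / 3 / (C1 * ‖u‖ + 1)) :=
    nhdsWithin_le_nhds (Iio_mem_nhds (by
      have : 0 < min δ (c / 3 / (C1 * ‖u‖ + 1)) := lt_min hδ (by positivity)
      linarith))
  filter_upwards [e1, e2, self_mem_nhdsWithin] with r q1 q2 q3
  have q3 : t < r := q3
  have hs0 : 0 < r - t := by linarith
  have hr : r = (r - t) + t := by ring
  have m1 := min_le_left δ (c / 3 / (C1 * ‖u‖ + 1))
  have m2 := min_le_right δ (c / 3 / (C1 * ‖u‖ + 1))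
  have f1 := h1 (r - t) hs0.le (by linarith)
  rw [← S_add Q.D hs0.le ht, sub_add_cancel] at f1
  set v := Q.D.S t u
  set w := Q.D.S r u
  have hw : ‖w‖ ≤ ‖u‖ := S_norm Q.D (ht.trans q3.le) u
  have k : ∀ s {Φ : ℝ × (Fin d → ℝ) → ℝ}, Continuous Φ → Continuous fun x => Φ (s, x) :=
    fun s _ h => h.comp (by fun_prop)
  -- time Taylor
  have f2 : |(∫ x, w x * φ (r, x)) - (∫ x, w x * φ (t, x)) - (r - t) * ∫ x, w x * pdt φ (t, x)|
      ≤ (r - t) * (c / 3) := by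
    have i1 := L1d_pair_int w (k r hφ.continuous) (fun x => b3 (r, x))
    have i2 := L1d_pair_int w (k t hφ.continuous) (fun x => b3 (t, x))
    have i3 := (L1d_pair_int w (k t (pdt_cont hφ)) (fun x => b2 (t, x))).const_mul (r - t)
    have i12 : Integrable (fun x => w x * φ (r, x) - w x * φ (t, x)) := i1.sub i2
    rw [← integral_const_mul, ← integral_sub i1 i2, ← integral_sub i12 i3]
    have e : ∀ x, w x * φ (r, x) - w x * φ (t, x) - (r - t) * (w x * pdt φ (t, x)) =
        w x * (φ (r, x) - φ (t, x) - (r - t) * pdt φ (t, x)) := fun x => by ring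
    simp only [e]
    have hb : ∀ x, |φ (r, x) - φ (t, x) - (r - t) * pdt φ (t, x)| ≤ C1 * (r - t) ^ 2 := by
      intro x
      have := b1 (t, x) (r - t, 0)
      have h2 : fderiv ℝ φ (t, x) (r - t, 0) = (r - t) * pdt φ (t, x) := by
        have : ((r - t, 0) : ℝ × (Fin d → ℝ)) = (r - t) • ((1 : ℝ), (0 : Fin d → ℝ)) := by
          ext <;> simp
        rw [this, map_smul, pdt, smul_eq_mul]
      have h3 : ‖((r - t, 0) : ℝ × (Fin d → ℝ))‖ = r - t := by
        rw [Prod.norm_mk, norm_zero, Real.norm_eq_abs, abs_of_pos hs0, max_eq_left hs0.le]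
      rw [h2, h3, Prod.mk_add_mk, add_zero, add_sub_cancel, Real.norm_eq_abs] at this
      exact this
    refine (L1d_pair_le w hb).trans ?_
    have hlt : r - t ≤ c / 3 / (C1 * ‖u‖ + 1) := by linarith
    rw [le_div_iff₀ (by positivity)] at hlt
    calc C1 * (r - t) ^ 2 * ‖w‖ ≤ C1 * (r - t) ^ 2 * ‖u‖ := by gcongr
      _ = (r - t) * ((r - t) * (C1 * ‖u‖)) := by ring
      _ ≤ (r - t) * (c / 3) := by
        gcongr
        linarith
  have f3 : |(r - t) * (∫ x, w x * pdt φ (t, x)) - (r - t) * ∫ x, v x * pdt φ (t, x)| ≤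
      (r - t) * (c / 3) := by
    rw [← mul_sub, abs_mul, abs_of_pos hs0, ← L1d_pair_sub w v (k t (pdt_cont hφ)) (fun x => b2 (t, x))]
    gcongr
    refine (L1d_pair_le _ (fun x => b2 (t, x))).trans ?_
    rw [lt_div_iff₀ (by positivity)] at q1
    nlinarith [norm_nonneg (w - v)]
  rw [GG_J Q hφ hc t hB, Real.norm_eq_abs, Real.norm_eq_abs, abs_of_pos hs0, smul_eq_mul]
  rw [abs_le] at f1 f2 f3 ⊢
  constructor
  · linarith [f1.1, f2.1, f3.1]
  · linarith [f1.2, f2.2, f3.2]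

lemma fp_bdd (hφ : ContDiff ℝ 3 φ) (hc : HasCompactSupport φ) {B : ℝ} (hB : 0 ≤ B)
    (h0 : ∀ x, (0, x) ∉ tsupport φ) (h1 : ∀ x, (B, x) ∉ tsupport φ)
    {M : ℝ} (hM : 0 ≤ M) {u : L1d d} (hu : Bd M u) :
    ∫ t in (0:ℝ)..B, Q.GG φ t (Q.D.S t u) = 0 := by
  obtain ⟨C3, hC3, b3⟩ := bdd_of_cs hφ.continuous hc
  have hS : ContinuousOn (fun t => Q.D.S t u) (Set.Icc 0 B) :=
    (S_cont Q.D u).mono Set.Icc_subset_Ici_self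
  rw [intervalIntegral.integral_eq_sub_of_hasDeriv_right_of_le hB
    (f := fun t => ∫ x, Q.D.S t u x * φ (t, x))
    (pair_time_cont hφ.continuous b3 hS)
    (fun t ht => g_deriv Q hφ hc hM hu ht.1.le)
    (ContinuousOn.intervalIntegrable_of_Icc hB (GG_timecont Q hφ hc hS))]
  have z0 : ∀ x, φ (0, x) = 0 := fun x => image_eq_zero_of_notMem_tsupport (h0 x)
  have z1 : ∀ x, φ (B, x) = 0 := fun x => image_eq_zero_of_notMem_tsupport (h1 x)
  simp [z0, z1]

lemma fp_all (hφ : ContDiff ℝ 3 φ) (hc : HasCompactSupport φ) {B : ℝ} (hB : 0 ≤ B)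
    (h0 : ∀ x, (0, x) ∉ tsupport φ) (h1 : ∀ x, (B, x) ∉ tsupport φ) (u : L1d d) :
    ∫ t in (0:ℝ)..B, Q.GG φ t (Q.D.S t u) = 0 := by
  obtain ⟨K, hK, hb⟩ := GG_bdd Q hφ hc
  have hcont : Continuous fun u : L1d d => ∫ t in (0:ℝ)..B, Q.GG φ t (Q.D.S t u) := by
    rw [continuous_iff_continuousAt]
    intro u0
    refine intervalIntegral.continuousAt_of_dominated_interval (bound := fun _ => K * (‖u0‖ + 1))
      ?_ ?_ ?_ ?_
    · refine Eventually.of_forall fun u => ?_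
      have hS : ContinuousOn (fun t => Q.D.S t u) (Set.Icc 0 B) :=
        (S_cont Q.D u).mono Set.Icc_subset_Ici_self
      rw [Set.uIoc_of_le hB]
      exact (ContinuousOn.intervalIntegrable_of_Icc hB
        (GG_timecont Q hφ hc hS) (μ := volume)).1.aestronglyMeasurable
    · have : ∀ᶠ u in nhds u0, ‖u‖ < ‖u0‖ + 1 :=
        (continuous_norm.tendsto u0).eventually_lt_const (by linarith)
      filter_upwards [this] with u hu
      refine ae_of_all _ fun t ht => ?_
      rw [Set.uIoc_of_le hB] at ht
      refine (hb t _).trans ?_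
      have := S_norm Q.D ht.1.le u
      gcongr
      linarith
    · exact intervalIntegrable_const
    · refine ae_of_all _ fun t ht => ?_
      rw [Set.uIoc_of_le hB] at ht
      have hl : Continuous (Q.D.S t) := by
        refine LipschitzWith.continuous (K := 1) (LipschitzWith.of_dist_le_mul fun u v => ?_)
        rw [dist_eq_norm, dist_eq_norm, NNReal.coe_one, one_mul]
        exact S_contr Q.D ht.1.le u v
      exact ((GG_cont Q hφ hc t).comp hl).continuousAt
  have hcl : IsClosed {u : L1d d | ∫ t in (0:ℝ)..B, Q.GG φ t (Q.D.S t u) = 0} :=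
    isClosed_eq hcont continuous_const
  have : u ∈ closure {u : L1d d | ∫ t in (0:ℝ)..B, Q.GG φ t (Q.D.S t u) = 0} := by
    rw [Metric.mem_closure_iff]
    intro ε hε
    obtain ⟨v, M, hM, hv, hd⟩ := Bd_dense u (half_pos hε)
    refine ⟨v, fp_bdd Q hφ hc hB h0 h1 hM hv, ?_⟩
    rw [dist_eq_norm]
    linarith
  rwa [hcl.closure_eq] at this

lemma fp_sol (u : L1d d) : IsFPESol' Q.a Q.b (fun t x => Q.D.S t u x) := by
  intro φ hφ' hc hs
  have hφ : ContDiff ℝ 3 φ := contDiff_infty.1 hφ' 3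
  obtain ⟨B0, hB0⟩ := (hc.isCompact.image continuous_fst).bddAbove
  set B := |B0| + 1
  have hlt : ∀ p ∈ tsupport φ, p.1 < B := fun p hp => by
    have := hB0 ⟨p, hp, rfl⟩
    have := le_abs_self B0
    linarith
  have hB : 0 ≤ B := by positivity
  have h0 : ∀ x, (0, x) ∉ tsupport φ := fun x h => by
    have h2 : (0:ℝ) < 0 := hs h
    exact lt_irrefl _ h2
  have hBt : ∀ t, B ≤ t → ∀ x, (t, x) ∉ tsupport φ := fun t ht x h => absurd (hlt _ h) (not_lt.2 ht)
  have key := fp_all Q hφ hc hB h0 (hBt B le_rfl) u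
  change ∫ t in Set.Ioi (0:ℝ), Q.GG φ t (Q.D.S t u) = 0
  rw [intervalIntegral.integral_of_le hB] at key
  refine Eq.trans ?_ key
  refine (setIntegral_eq_of_subset_of_forall_sdiff_eq_zero measurableSet_Ioi
    Set.Ioc_subset_Ioi_self fun t ht => ?_)
  refine GG_zero Q (hBt t ?_) _
  by_contra h
  exact ht.2 ⟨ht.1, (not_le.1 h).le⟩

end final

/-- under (H1)′–(H3)′, the degenerate nonlinear Fokker–Planck equation
generates a continuous contraction semigroup on `L¹(ℝ^d)`. -/
theorem statement16 (d : ℕ) (a : Fin d → Fin d → ℝ → ℝ) (b : Fin d → ℝ → ℝ)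
    (hd : 1 ≤ d)
    (ha_smooth : ∀ i j, ContDiff ℝ 2 (a i j))
    (ha_bdd : ∀ i j, ∃ M : ℝ, ∀ r : ℝ, |a i j r| ≤ M)
    (ha_symm : ∀ i j r, a i j r = a j i r)
    (hH2 : ∀ (r : ℝ) (ξ : Fin d → ℝ),
      0 ≤ ∑ i, ∑ j, (a i j r + r * deriv (a i j) r) * ξ i * ξ j)
    (hb_smooth : ∀ i, ContDiff ℝ 1 (b i))
    (hb_bdd : ∀ i, ∃ M : ℝ, ∀ r : ℝ, |b i r| ≤ M)
    (hb_zero : ∀ i, b i 0 = 0)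
 :
    ∃ S : ℝ → Lp ℝ 1 (volume : Measure (Fin d → ℝ)) → Lp ℝ 1 (volume : Measure (Fin d → ℝ)),
      (∀ v, S 0 v = v) ∧
      (∀ t s : ℝ, 0 ≤ t → 0 ≤ s → ∀ v, S (t + s) v = S t (S s v)) ∧
      (∀ t : ℝ, 0 ≤ t → ∀ v w, ‖S t v - S t w‖ ≤ ‖v - w‖) ∧
      (∀ u₀, ContinuousOn (fun t => S t u₀) (Set.Ici (0 : ℝ))) ∧
      (∀ u₀, IsFPESol' a b (fun t x => (S t u₀ : (Fin d → ℝ) → ℝ) x)) := by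
  choose Ca hCa using ha_bdd
  choose Cb hCb using hb_bdd
  let Q : FPCoef d := ⟨a, b, Ca, Cb, hd, fun i j => (ha_smooth i j).of_le (by norm_num), hCa,
    ha_symm, hH2, hb_smooth, hCb⟩
  exact ⟨Q.D.S, S_zero Q.D, fun t s ht hs v => S_add Q.D ht hs v,
    fun t ht v w => S_contr Q.D ht v w, S_cont Q.D, fun u => fp_sol Q u⟩
end
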